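/- arXiv:2309.16607 — 2 statements merged into one kernel-verified Lean document; each statement's English description precedes it below -/
import Mathlib

section
/- Fix a positive integer n and a partition μ. Then there exists a family of polynomials g_λ(t) ∈ ℤ[t], indexed by the partitions λ of n, such that for every prime power q and every matrix Δ ∈ M_n(𝔽_q), the number σ(μ,Δ) of subspaces of 𝔽_q^n with Δ-profile μ satisfies σ(μ,Δ) = Σ_{λ ⊢ n} g_λ(q) · X_λ(Δ). -/
open Matrix Module Polynomial

attribute [local instance] Classical.propDecidable

/-- `μ` is a partition: its parts are weakly decreasing. -/
def IsPtn (μ : ℕ →₀ ℕ) : Prop := ∀ i, μ (i + 1) ≤ μ i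

/-- The size `|μ|` of a partition. -/
def ptnSize (μ : ℕ →₀ ℕ) : ℕ := μ.sum fun _ v => v

/-- `W + ΔW + ⋯ + Δ^{j-1}W`. -/
noncomputable def iterSpan {F : Type} [Field F] {n : ℕ} (Δ : Matrix (Fin n) (Fin n) F)
    (W : Submodule F (Fin n → F)) (j : ℕ) : Submodule F (Fin n → F) :=
  ⨆ i ∈ Finset.range j, W.map (Δ ^ i).mulVecLin

/-- `W` has `Δ`-profile `μ`. -/
def HasProfile {F : Type} [Field F] {n : ℕ} (Δ : Matrix (Fin n) (Fin n) F)
    (μ : ℕ →₀ ℕ) (W : Submodule F (Fin n → F)) : Prop :=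
  ∀ j : ℕ, Module.finrank F (iterSpan Δ W (j + 1)) = ∑ i ∈ Finset.range (j + 1), μ i

/-- `σ(μ, Δ)`: the number of subspaces with `Δ`-profile `μ`. -/
noncomputable def sigmaProf {F : Type} [Field F] {n : ℕ} (μ : ℕ →₀ ℕ)
    (Δ : Matrix (Fin n) (Fin n) F) : ℕ :=
  Nat.card {W : Submodule F (Fin n → F) // HasProfile Δ μ W}

/-- `X_α(Δ)`: the number of flags of `Δ`-invariant subspaces with successive
quotient dimensions given by `α`. -/
noncomputable def Xflag {F : Type} [Field F] {n ℓ : ℕ} (Δ : Matrix (Fin n) (Fin n) F)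
    (α : Fin ℓ → ℕ) : ℕ :=
  Nat.card {W : Fin (ℓ + 1) → Submodule F (Fin n → F) //
    Monotone W ∧ W 0 = ⊥ ∧ W (Fin.last ℓ) = ⊤ ∧
    (∀ i, (W i).map Δ.mulVecLin ≤ W i) ∧
    ∀ i : Fin ℓ, Module.finrank F (W i.succ) = Module.finrank F (W i.castSucc) + α i}

/-- The Gaussian binomial coefficient as a polynomial in `t`. -/
noncomputable def qbp : ℕ → ℕ → Polynomial ℤ
  | _, 0 => 1
  | 0, _ + 1 => 0
  | a + 1, b + 1 => qbp a b + Polynomial.X ^ (b + 1) * qbp a (b + 1)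

/-- The `q`-integer `[m]_t`. -/
def qNat (t : ℚ) (m : ℕ) : ℚ := ∑ i ∈ Finset.range m, t ^ i

/-- The `q`-factorial `[m]_t!`. -/
def qFact (t : ℚ) (m : ℕ) : ℚ := ∏ i ∈ Finset.range m, qNat t (i + 1)




section SubspaceCount

theorem qbp_zero_right (m : ℕ) : qbp m 0 = 1 := by cases m <;> simp [qbp]
theorem qbp_succ_succ (a b : ℕ) :
    qbp (a + 1) (b + 1) = qbp a b + Polynomial.X ^ (b + 1) * qbp a (b + 1) := by
  rw [qbp]
theorem qbp_of_lt : ∀ (m k : ℕ), m < k → qbp m k = 0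
  | 0, k + 1, _ => by rw [qbp]
  | m + 1, k + 1, h => by
    rw [qbp_succ_succ, qbp_of_lt m k (by omega), qbp_of_lt m (k + 1) (by omega)]; simp
theorem qbp_self : ∀ (m : ℕ), qbp m m = 1
  | 0 => qbp_zero_right 0
  | m + 1 => by rw [qbp_succ_succ, qbp_self m, qbp_of_lt m (m + 1) (by omega)]; simp

/-- The number of linearly independent tuples, as an integer. -/
def liCount (q : ℤ) (m k : ℕ) : ℤ := ∏ i ∈ Finset.range k, (q ^ m - q ^ i)

theorem liCount_succ (q : ℤ) (m k : ℕ) :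
    liCount q m (k + 1) = liCount q m k * (q ^ m - q ^ k) := by
  simp [liCount, Finset.prod_range_succ]

theorem liCount_succ_succ (q : ℤ) (m k : ℕ) :
    liCount q (m + 1) (k + 1) = (q ^ (m + 1) - 1) * q ^ k * liCount q m k := by
  simp only [liCount, Finset.prod_range_succ' _ k]
  have : ∀ i, q ^ (m + 1) - q ^ (i + 1) = q * (q ^ m - q ^ i) := fun i => by ring
  simp only [this, Finset.prod_mul_distrib, Finset.prod_const, Finset.card_range, pow_zero]
  ring

theorem qbp_mul_liCount (q : ℤ) : ∀ (m k : ℕ),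
    (qbp m k).eval q * liCount q k k = liCount q m k
  | m, 0 => by simp [qbp_zero_right, liCount]
  | 0, k + 1 => by
    rw [qbp_of_lt 0 (k + 1) (by omega)]
    simp [liCount, Finset.prod_range_succ']
  | m + 1, k + 1 => by
    have h1 := qbp_mul_liCount q m k
    have h2 := qbp_mul_liCount q m (k + 1)
    rw [qbp_succ_succ, liCount_succ_succ q m k]
    simp only [eval_add, eval_mul, eval_pow, eval_X, add_mul]
    rw [mul_assoc, h2, liCount_succ q m k, liCount_succ_succ q k k]
    linear_combination ((q ^ (k + 1) - 1) * q ^ k) * h1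

theorem liCount_pos (q : ℤ) (hq : 1 < q) (k : ℕ) : 0 < liCount q k k := by
  apply Finset.prod_pos
  intro i hi
  have := pow_lt_pow_right₀ hq (Finset.mem_range.1 hi)
  linarith

variable {F : Type} [Field F] [Fintype F] {V : Type} [AddCommGroup V] [Module F V]
  [Module.Finite F V]

theorem card_li (k : ℕ) (hk : k ≤ finrank F V) :
    (Nat.card { s : Fin k → V // LinearIndependent F s } : ℤ)
      = liCount (Fintype.card F) (finrank F V) k := by
  have : Finite V := Module.finite_of_finite F
  have : Fintype V := Fintype.ofFinite V
  rw [card_linearIndependent hk, liCount, Finset.prod_range]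
  push_cast
  apply Finset.prod_congr rfl
  intro i _
  rw [Nat.cast_sub]
  · push_cast; rfl
  · exact Nat.pow_le_pow_right Fintype.card_pos (by omega)

theorem card_subspaces (k : ℕ) :
    (Nat.card {U : Submodule F V // finrank F U = k} : ℤ)
      = (qbp (finrank F V) k).eval (Fintype.card F : ℤ) := by
  have hV : Finite V := Module.finite_of_finite F
  have hfs : Finite (Submodule F V) := inferInstance
  have hq : (1 : ℤ) < Fintype.card F := by exact_mod_cast Fintype.one_lt_card
  by_cases hk : k ≤ finrank F V
  swap
  · rw [qbp_of_lt _ _ (by omega)]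
    have : IsEmpty {U : Submodule F V // finrank F U = k} := ⟨fun U => by
      have := Submodule.finrank_le U.1
      have := U.2
      omega⟩
    simp
  have key : (Nat.card {U : Submodule F V // finrank F U = k} : ℤ) *
      liCount (Fintype.card F) k k = liCount (Fintype.card F) (finrank F V) k := by
    rw [← card_li k hk]
    let e : { s : Fin k → V // LinearIndependent F s } ≃
        Σ U : {U : Submodule F V // finrank F U = k},
          { s : Fin k → U.1 // LinearIndependent F s } :=
      { toFun := fun s => ⟨⟨Submodule.span F (Set.range s.1), by
            rw [finrank_span_eq_card s.2]; simp⟩,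
          ⟨fun i => ⟨s.1 i, Submodule.subset_span ⟨i, rfl⟩⟩, by
            apply LinearIndependent.of_comp (Submodule.subtype _)
            exact s.2⟩⟩
        invFun := fun p => ⟨fun i => (p.2.1 i : V),
          p.2.2.map' (Submodule.subtype _) (Submodule.ker_subtype _)⟩
        left_inv := fun s => rfl
        right_inv := by
          rintro ⟨⟨U, hU⟩, ⟨s, hs⟩⟩
          dsimp only at s
          have hspan : Submodule.span F (Set.range fun i => (s i : V)) = U := by
            apply Submodule.eq_of_le_of_finrank_eq
            · rw [Submodule.span_le]
              rintro _ ⟨i, rfl⟩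
              exact (s i).2
            · have := finrank_span_eq_card
                (hs.map' (Submodule.subtype U) (Submodule.ker_subtype _))
              rw [hU]
              exact this.trans (by simp)
          have h1 : (⟨Submodule.span F (Set.range fun i => (s i : V)), by rw [hspan, hU]⟩ :
              {U : Submodule F V // finrank F U = k}) = ⟨U, hU⟩ := Subtype.ext hspan
          have gen : ∀ (P Q : {U : Submodule F V // finrank F U = k}) (_ : P = Q)
              (s : { s : Fin k → P.1 // LinearIndependent F s })
              (t : { s : Fin k → Q.1 // LinearIndependent F s }),
              (∀ i, (s.1 i : V) = t.1 i) →
              (⟨P, s⟩ : Σ U : {U : Submodule F V // finrank F U = k},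
                { s : Fin k → U.1 // LinearIndependent F s }) = ⟨Q, t⟩ := by
            rintro P _ rfl s t h
            congr 1
            apply Subtype.ext
            funext i
            exact Subtype.ext (h i)
          exact gen _ _ h1 _ _ (fun i => rfl) }
    rw [Nat.card_congr e]
    have : Fintype {U : Submodule F V // finrank F U = k} := Fintype.ofFinite _
    rw [Nat.card_sigma, Nat.cast_sum]
    have : ∀ U : {U : Submodule F V // finrank F U = k},
        (Nat.card { s : Fin k → U.1 // LinearIndependent F s } : ℤ)
          = liCount (Fintype.card F) k k := by
      rintro ⟨U, hU⟩
      rw [card_li k (by simp [hU]), hU]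
    simp only [this]
    simp
  have h2 := qbp_mul_liCount (Fintype.card F : ℤ) (finrank F V) k
  have h3 := liCount_pos _ hq k
  exact mul_right_cancel₀ h3.ne' (key.trans h2.symm)

theorem finrank_map_add_inf {V' : Type} [AddCommGroup V'] [Module F V'] (f : V →ₗ[F] V')
    (S : Submodule F V) :
    finrank F (S.map f) + finrank F (S ⊓ LinearMap.ker f : Submodule F V) = finrank F S := by
  have h := LinearMap.finrank_range_add_finrank_ker (f.domRestrict S)
  rw [LinearMap.range_domRestrict, LinearMap.ker_domRestrict] at h
  rw [← h, ← Submodule.finrank_map_subtype_eq S, Submodule.map_comap_subtype]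

/-- The interval between two subspaces and the subspaces of the quotient. -/
noncomputable def ivEquiv (A B : Submodule F V) (hAB : A ≤ B) :
    Submodule F (B ⧸ A.comap B.subtype) ≃ {U : Submodule F V // A ≤ U ∧ U ≤ B} where
  toFun U' := ⟨(U'.comap (A.comap B.subtype).mkQ).map B.subtype, by
    constructor
    · intro a ha
      refine ⟨⟨a, hAB ha⟩, ?_, rfl⟩
      have : (A.comap B.subtype).mkQ ⟨a, hAB ha⟩ = 0 := by
        rw [Submodule.mkQ_apply, Submodule.Quotient.mk_eq_zero]
        exact ha
      simp only [Submodule.comap_coe, Set.mem_preimage, this]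
      exact U'.zero_mem
    · exact Submodule.map_subtype_le _ _⟩
  invFun U := (U.1.comap B.subtype).map (A.comap B.subtype).mkQ
  left_inv U' := by
    dsimp only
    rw [Submodule.comap_map_eq_of_injective B.injective_subtype,
      Submodule.map_comap_eq_of_surjective (Submodule.mkQ_surjective _)]
  right_inv U := by
    apply Subtype.ext
    dsimp only
    rw [Submodule.comap_map_eq, Submodule.ker_mkQ, sup_eq_left.2 (Submodule.comap_mono U.2.1),
      Submodule.map_comap_subtype, inf_eq_right.2 U.2.2]

theorem ivEquiv_finrank (A B : Submodule F V) (hAB : A ≤ B)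
    (U' : Submodule F (B ⧸ A.comap B.subtype)) :
    finrank F (ivEquiv A B hAB U').1 = finrank F U' + finrank F A := by
  change finrank F ((U'.comap (A.comap B.subtype).mkQ).map B.subtype) = _
  rw [Submodule.finrank_map_subtype_eq]
  have h := finrank_map_add_inf (A.comap B.subtype).mkQ (U'.comap (A.comap B.subtype).mkQ)
  rw [Submodule.map_comap_eq_of_surjective (Submodule.mkQ_surjective _), Submodule.ker_mkQ,
    inf_eq_right.2 (by
      intro x hx
      rw [Submodule.mem_comap, Submodule.mkQ_apply, (Submodule.Quotient.mk_eq_zero _).2 hx]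
      exact U'.zero_mem), (Submodule.comapSubtypeEquivOfLe hAB).finrank_eq] at h
  exact h.symm

/-- Subspaces between two given ones. -/
theorem card_between (A B : Submodule F V) (hAB : A ≤ B) (k : ℕ) (hk : finrank F A ≤ k) :
    (Nat.card {U : Submodule F V // finrank F U = k ∧ A ≤ U ∧ U ≤ B} : ℤ)
      = (qbp (finrank F B - finrank F A) (k - finrank F A)).eval (Fintype.card F : ℤ) := by
  have hA' : finrank F (A.comap B.subtype) = finrank F A :=
    (Submodule.comapSubtypeEquivOfLe hAB).finrank_eq
  have hQ : finrank F (B ⧸ A.comap B.subtype) = finrank F B - finrank F A := by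
    have := (A.comap B.subtype).finrank_quotient_add_finrank
    omega
  rw [← hQ, ← card_subspaces]
  congr 1
  refine (Nat.card_congr
    (Equiv.trans ((ivEquiv A B hAB).subtypeEquiv (q := fun U => finrank F U.1 = k) ?_)
      ((Equiv.subtypeSubtypeEquivSubtypeInter _ (fun U : Submodule F V => finrank F U = k)).trans
        (Equiv.subtypeEquivRight ?_)))).symm
  · intro U'
    rw [ivEquiv_finrank]
    omega
  · intro U
    tauto

end SubspaceCount


section Duality

variable {F : Type} [Field F]

theorem exists_form_quot (p : F[X]) (hp : Irreducible p) (e : ℕ) :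
    ∃ B : (F[X] ⧸ (Ideal.span {p ^ e})) →ₗ[F] (F[X] ⧸ (Ideal.span {p ^ e})) →ₗ[F] F,
      (∀ x y, B ((X : F[X]) • x) y = B x ((X : F[X]) • y)) ∧ ∀ x, x ≠ 0 → ∃ y, B x y ≠ 0 := by
  obtain ⟨τ, hτ⟩ : ∃ τ : (F[X] ⧸ (Ideal.span {p ^ e})) →ₗ[F] F,
      ∀ x, x ≠ 0 → ∃ y, τ (x * y) ≠ 0 := by
    rcases Nat.eq_zero_or_pos e with rfl | he
    · refine ⟨0, fun x hx => (hx ?_).elim⟩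
      obtain ⟨x, rfl⟩ := Ideal.Quotient.mk_surjective x
      rw [Ideal.Quotient.eq_zero_iff_mem]
      simp
    have hne : Ideal.Quotient.mk (Ideal.span {p ^ e}) (p ^ (e - 1)) ≠ 0 := by
      rw [Ne, Ideal.Quotient.eq_zero_iff_mem, Ideal.mem_span_singleton,
        pow_dvd_pow_iff hp.ne_zero hp.not_isUnit]
      omega
    obtain ⟨τ, hτ⟩ : ∃ τ : (F[X] ⧸ (Ideal.span {p ^ e})) →ₗ[F] F,
        τ (Ideal.Quotient.mk (Ideal.span {p ^ e}) (p ^ (e - 1))) ≠ 0 := by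
      by_contra hcon
      push Not at hcon
      exact hne ((Module.forall_dual_apply_eq_zero_iff F _).1 hcon)
    refine ⟨τ, fun x hx => ?_⟩
    obtain ⟨x, rfl⟩ := Ideal.Quotient.mk_surjective x
    rw [Ne, Ideal.Quotient.eq_zero_iff_mem, Ideal.mem_span_singleton] at hx
    have hx0 : x ≠ 0 := by rintro rfl; simp at hx
    obtain ⟨k, u, hu, rfl⟩ := WfDvdMonoid.max_power_factor hx0 hp
    have hk : k < e := by
      by_contra hk
      exact hx (Dvd.dvd.mul_right (pow_dvd_pow p (by omega)) u)
    have hcop : IsCoprime (p ^ e) u := IsCoprime.pow_left ((hp.coprime_iff_not_dvd).2 hu)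
    obtain ⟨a, b, hab⟩ := hcop
    refine ⟨Ideal.Quotient.mk _ (b * p ^ (e - 1 - k)), ?_⟩
    rw [← map_mul]
    convert hτ using 2
    rw [Ideal.Quotient.mk_eq_mk_iff_sub_mem, Ideal.mem_span_singleton]
    refine ⟨- a * p ^ (e - 1), ?_⟩
    have h1 : p ^ (e - 1) = p ^ k * p ^ (e - 1 - k) := by rw [← pow_add]; congr 1; omega
    rw [h1]
    linear_combination (p ^ k * p ^ (e - 1 - k)) * hab
  refine ⟨(LinearMap.mul F _).compr₂ τ, ?_, ?_⟩
  · intro x y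
    simp [smul_mul_assoc, mul_smul_comm]
  · intro x hx
    simpa using hτ x hx

theorem exists_form_directSum {ι : Type} [Fintype ι] (M : ι → Type) [∀ i, AddCommGroup (M i)]
    [∀ i, Module F[X] (M i)] [∀ i, Module F (M i)] [∀ i, IsScalarTower F F[X] (M i)]
    (h : ∀ i, ∃ B : M i →ₗ[F] M i →ₗ[F] F,
      (∀ x y, B ((X : F[X]) • x) y = B x ((X : F[X]) • y)) ∧ ∀ x, x ≠ 0 → ∃ y, B x y ≠ 0) :
    ∃ B : (DirectSum ι M) →ₗ[F] (DirectSum ι M) →ₗ[F] F,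
      (∀ x y, B ((X : F[X]) • x) y = B x ((X : F[X]) • y)) ∧ ∀ x, x ≠ 0 → ∃ y, B x y ≠ 0 := by
  choose B hB1 hB2 using h
  refine ⟨∑ i, (B i).compl₁₂ (DirectSum.component F ι M i) (DirectSum.component F ι M i), ?_, ?_⟩
  · intro x y
    simp only [LinearMap.sum_apply, LinearMap.compl₁₂_apply]
    refine Finset.sum_congr rfl fun i _ => ?_
    exact hB1 i (x i) (y i)
  · intro x hx
    have : ∃ i, x i ≠ 0 := by
      by_contra hcon
      push Not at hcon
      exact hx (DFinsupp.ext hcon)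
    obtain ⟨i, hi⟩ := this
    obtain ⟨y, hy⟩ := hB2 i _ hi
    refine ⟨DirectSum.lof F ι M i y, ?_⟩
    simp only [LinearMap.sum_apply, LinearMap.compl₁₂_apply]
    rw [Finset.sum_eq_single i]
    · rw [DirectSum.component.lof_self]
      exact hy
    · intro j _ hj
      rw [DirectSum.component.of, dif_neg (Ne.symm hj)]
      simp
    · simp

theorem exists_form {Q : Type} [AddCommGroup Q] [Module F Q] [Module.Finite F Q]
    (T : Q →ₗ[F] Q) : ∃ B : Q →ₗ[F] Q →ₗ[F] F,
      (∀ x y, B (T x) y = B x (T y)) ∧ ∀ x, x ≠ 0 → ∃ y, B x y ≠ 0 := by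
  have htor : Module.IsTorsion F[X] (AEval' T) := AEval.isTorsion_of_finiteDimensional F Q T
  obtain ⟨ι, _, p, hp, e, ⟨ψ⟩⟩ := Module.equiv_directSum_of_isTorsion htor
  obtain ⟨B, hB1, hB2⟩ := exists_form_directSum (F := F)
    (fun i => F[X] ⧸ (Ideal.span {p i ^ e i})) (fun i => exists_form_quot (p i) (hp i) (e i))
  let ψ' : AEval' T →ₗ[F] (DirectSum ι fun i => F[X] ⧸ (Ideal.span {p i ^ e i})) :=
    ψ.toLinearMap.restrictScalars F
  let φ : Q →ₗ[F] (DirectSum ι fun i => F[X] ⧸ (Ideal.span {p i ^ e i})) :=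
    ψ' ∘ₗ (AEval'.of T).toLinearMap
  have hφ : ∀ x, φ (T x) = (X : F[X]) • φ x := by
    intro x
    change ψ (AEval'.of T (T x)) = _
    rw [← AEval'.X_smul_of, map_smul]
    rfl
  have hbij : Function.Bijective φ := ψ.bijective.comp (AEval'.of T).bijective
  refine ⟨B.compl₁₂ φ φ, ?_, ?_⟩
  · intro x y
    simp only [LinearMap.compl₁₂_apply, hφ, hB1]
  · intro x hx
    obtain ⟨y, hy⟩ := hB2 (φ x) (by rwa [Ne, map_eq_zero_iff _ hbij.1])
    obtain ⟨y, rfl⟩ := hbij.2 y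
    exact ⟨y, hy⟩

theorem card_inv_le [Finite F] {Q : Type} [AddCommGroup Q] [Module F Q] [Module.Finite F Q]
    (T : Q →ₗ[F] Q) (a b : ℕ) (hab : a + b = finrank F Q) :
    Nat.card {U : Submodule F Q // U.map T ≤ U ∧ finrank F U = a} ≤
      Nat.card {U : Submodule F Q // U.map T ≤ U ∧ finrank F U = b} := by
  have : Finite Q := Module.finite_of_finite F
  obtain ⟨B, hB1, hB2⟩ := exists_form T
  have hinj : Function.Injective B := by
    rw [injective_iff_map_eq_zero]
    intro x hx
    by_contra hne
    obtain ⟨y, hy⟩ := hB2 x hne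
    exact hy (by simp [hx])
  let φ : Q ≃ₗ[F] Dual F Q := LinearEquiv.ofInjectiveOfFinrankEq B hinj
    (Subspace.dual_finrank_eq).symm
  have hφ : ∀ x y, φ x y = B x y := fun x y => rfl
  let e : Submodule F Q ≃ Submodule F Q :=
    (Subspace.orderIsoFiniteDimensional (K := F) (V := Q)).toEquiv.trans
      ((OrderDual.ofDual).trans (Submodule.orderIsoMapComap φ.symm).toEquiv)
  have he : ∀ U, e U = (U.dualAnnihilator).comap φ.toLinearMap := by
    intro U
    change U.dualAnnihilator.map φ.symm.toLinearMap = _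
    rw [Submodule.map_equiv_eq_comap_symm]; rfl
  have hmem : ∀ U x, x ∈ e U ↔ ∀ y ∈ U, B x y = 0 := by
    intro U x
    rw [he, Submodule.mem_comap, Submodule.mem_dualAnnihilator]
    rfl
  have hfin : ∀ U, finrank F (e U) + finrank F U = finrank F Q := by
    intro U
    have h1 : finrank F (e U) = finrank F U.dualAnnihilator := 
      LinearEquiv.finrank_eq (φ.symm.submoduleMap U.dualAnnihilator).symm
    rw [h1, add_comm, Subspace.finrank_add_finrank_dualAnnihilator_eq]
  have hinv : ∀ U, U.map T ≤ U → (e U).map T ≤ e U := by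
    rintro U hU _ ⟨x, hx, rfl⟩
    rw [hmem]
    intro y hy
    rw [hB1]
    exact (hmem U x).1 hx _ (hU ⟨y, hy, rfl⟩)
  refine Nat.card_le_card_of_injective
    (fun U => (⟨e U.1, hinv _ U.2.1, by have := hfin U.1; have := U.2.2; omega⟩ :
      {U : Submodule F Q // U.map T ≤ U ∧ finrank F U = b})) ?_
  intro U U' h
  exact Subtype.ext (e.injective (congrArg Subtype.val h))

theorem card_inv_symm [Finite F] {Q : Type} [AddCommGroup Q] [Module F Q] [Module.Finite F Q]
    (T : Q →ₗ[F] Q) (a b : ℕ) (hab : a + b = finrank F Q) :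
    Nat.card {U : Submodule F Q // U.map T ≤ U ∧ finrank F U = a} =
      Nat.card {U : Submodule F Q // U.map T ≤ U ∧ finrank F U = b} :=
  le_antisymm (card_inv_le T a b hab) (card_inv_le T b a (by omega))

/-- Invariant subspaces in an interval: complementary dimensions are equinumerous. -/
theorem card_inv_between_symm [Fintype F] {V : Type} [AddCommGroup V] [Module F V]
    [Module.Finite F V]
    (T : V →ₗ[F] V) (A B : Submodule F V) (hAB : A ≤ B) (hA : A.map T ≤ A) (hB : B.map T ≤ B)
    (a b : ℕ) (hab : finrank F A + a + b = finrank F B) :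
    Nat.card {U : Submodule F V // (A ≤ U ∧ U ≤ B) ∧ U.map T ≤ U ∧
        finrank F U = finrank F A + a} =
      Nat.card {U : Submodule F V // (A ≤ U ∧ U ≤ B) ∧ U.map T ≤ U ∧
        finrank F U = finrank F A + b} := by
  let TB : B →ₗ[F] B := T.restrict (fun x hx => hB ⟨x, hx, rfl⟩)
  let TQ : (B ⧸ A.comap B.subtype) →ₗ[F] (B ⧸ A.comap B.subtype) :=
    Submodule.mapQ _ _ TB (fun x hx => hA ⟨x.1, hx, rfl⟩)
  have hQ : finrank F (B ⧸ A.comap B.subtype) = finrank F B - finrank F A := by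
    have := (A.comap B.subtype).finrank_quotient_add_finrank
    have hA' : finrank F (A.comap B.subtype) = finrank F A :=
      (Submodule.comapSubtypeEquivOfLe hAB).finrank_eq
    omega
  have key : ∀ c, Nat.card {U : Submodule F V // (A ≤ U ∧ U ≤ B) ∧ U.map T ≤ U ∧
        finrank F U = finrank F A + c} =
      Nat.card {U : Submodule F (B ⧸ A.comap B.subtype) // U.map TQ ≤ U ∧ finrank F U = c} := by
    intro c
    refine (Nat.card_congr
      (Equiv.trans ((ivEquiv A B hAB).subtypeEquiv
        (q := fun U => U.1.map T ≤ U.1 ∧ finrank F U.1 = finrank F A + c) ?_)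
      (Equiv.subtypeSubtypeEquivSubtypeInter _
        (fun U : Submodule F V => U.map T ≤ U ∧ finrank F U = finrank F A + c)))).symm
    intro U'
    rw [ivEquiv_finrank, add_comm (finrank F A) c, add_left_inj]
    refine and_congr_left fun _ => ?_
    have hmem : ∀ x : B, (x : V) ∈ (ivEquiv A B hAB U').1 ↔ (A.comap B.subtype).mkQ x ∈ U' := by
      intro x
      change (x : V) ∈ (U'.comap (A.comap B.subtype).mkQ).map B.subtype ↔ _
      constructor
      · rintro ⟨y, hy, hyx⟩
        obtain rfl : y = x := Subtype.ext hyx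
        exact hy
      · intro h
        exact ⟨x, h, rfl⟩
    constructor
    · rintro h _ ⟨x, hx, rfl⟩
      have hxB : x ∈ B := (ivEquiv A B hAB U').2.2 hx
      have h1 := (hmem ⟨x, hxB⟩).1 hx
      exact (hmem (TB ⟨x, hxB⟩)).2 (h ⟨_, h1, rfl⟩)
    · rintro h _ ⟨x, hx, rfl⟩
      obtain ⟨x, rfl⟩ := Submodule.mkQ_surjective _ x
      exact (hmem (TB x)).1 (h ⟨_, (hmem x).2 hx, rfl⟩)
  rw [key, key, card_inv_symm TQ a b (by omega)]

end Duality


section FlagPerm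

set_option linter.unusedSectionVars false

/-- Fibration of a set of functions over its restrictions off one point. -/
theorem card_fib {I Y : Type} [DecidableEq I] [Finite I] [Finite Y] (x : I) (y0 : Y) (P : (I → Y) → Prop)
    [Fintype {W : I → Y // W x = y0}] :
    Nat.card {W : I → Y // P W} = ∑ W' : {W : I → Y // W x = y0},
      Nat.card {U : Y // P (Function.update W'.1 x U)} := by
  rw [← Nat.card_sigma]
  refine Nat.card_congr
    { toFun := fun W => ⟨⟨Function.update W.1 x y0, by simp⟩, ⟨W.1 x, by
        simpa using W.2⟩⟩
      invFun := fun p => ⟨Function.update p.1.1 x p.2.1, p.2.2⟩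
      left_inv := fun W => by simp
      right_inv := ?_ }
  rintro ⟨⟨W, hW⟩, ⟨U, hU⟩⟩
  have h1 : Function.update (Function.update W x U) x y0 = W := by
    subst hW; simp
  have gen : ∀ (P1 P2 : {W : I → Y // W x = y0}) (_ : P1 = P2)
      (s : {U : Y // P (Function.update P1.1 x U)}) (t : {U : Y // P (Function.update P2.1 x U)}),
      s.1 = t.1 → (⟨P1, s⟩ : Σ W' : {W : I → Y // W x = y0},
        {U : Y // P (Function.update W'.1 x U)}) = ⟨P2, t⟩ := by
    rintro P1 _ rfl s t h
    congr 1
    exact Subtype.ext h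
  exact gen _ _ (Subtype.ext h1) _ _ (by simp)

variable {F : Type} [Field F] [Fintype F] {n : ℕ}

/-- The flag condition of `Xflag`. -/
def FlagP {ℓ : ℕ} (Δ : Matrix (Fin n) (Fin n) F) (α : Fin ℓ → ℕ)
    (W : Fin (ℓ + 1) → Submodule F (Fin n → F)) : Prop :=
  Monotone W ∧ W 0 = ⊥ ∧ W (Fin.last ℓ) = ⊤ ∧
    (∀ i, (W i).map Δ.mulVecLin ≤ W i) ∧
    ∀ i : Fin ℓ, Module.finrank F (W i.succ) = Module.finrank F (W i.castSucc) + α i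

/-- The part of the flag condition not involving the middle subspace. -/
def FlagC {m : ℕ} (Δ : Matrix (Fin n) (Fin n) F) (α : Fin (m + 1) → ℕ) (i : Fin m)
    (W : Fin (m + 2) → Submodule F (Fin n → F)) : Prop :=
  (∀ a b, a ≠ i.succ.castSucc → b ≠ i.succ.castSucc → a ≤ b → W a ≤ W b) ∧
    W 0 = ⊥ ∧ W (Fin.last _) = ⊤ ∧
    (∀ a, a ≠ i.succ.castSucc → (W a).map Δ.mulVecLin ≤ W a) ∧
    (∀ j : Fin (m + 1), j ≠ i.castSucc → j ≠ i.succ →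
      Module.finrank F (W j.succ) = Module.finrank F (W j.castSucc) + α j) ∧
    finrank F (W i.castSucc.castSucc) + α i.castSucc + α i.succ = finrank F (W i.succ.succ)

theorem flagP_iff {m : ℕ} (Δ : Matrix (Fin n) (Fin n) F) (α : Fin (m + 1) → ℕ) (i : Fin m)
    (W : Fin (m + 2) → Submodule F (Fin n → F)) :
    FlagP Δ α W ↔ FlagC Δ α i W ∧
      ((W i.castSucc.castSucc ≤ W i.succ.castSucc ∧ W i.succ.castSucc ≤ W i.succ.succ) ∧
        (W i.succ.castSucc).map Δ.mulVecLin ≤ W i.succ.castSucc ∧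
        finrank F (W i.succ.castSucc) = finrank F (W i.castSucc.castSucc) + α i.castSucc) := by
  constructor
  · rintro ⟨h1, h2, h3, h4, h5⟩
    have e1 := h5 i.castSucc
    have e2 := h5 i.succ
    rw [Fin.succ_castSucc] at e1
    refine ⟨⟨fun a b _ _ h => h1 h, h2, h3, fun a _ => h4 a, fun j _ _ => h5 j, ?_⟩,
      ⟨h1 ?_, h1 ?_⟩, h4 _, e1⟩
    · omega
    · simp [Fin.le_def]
    · simp [Fin.le_def]
  · rintro ⟨⟨h1, h2, h3, h4, h5, h6⟩, ⟨h7, h8⟩, h9, h10⟩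
    refine ⟨?_, h2, h3, ?_, ?_⟩
    · intro a b hab
      by_cases ha : a = i.succ.castSucc
      · by_cases hb : b = i.succ.castSucc
        · rw [ha, hb]
        · rw [ha] at hab ⊢
          refine h8.trans (h1 _ _ ?_ hb ?_)
          · simp [Fin.ext_iff]
          · have : b.val ≠ i.val + 1 := fun h => hb (Fin.ext (by simpa using h))
            simp only [Fin.le_def, Fin.val_castSucc, Fin.val_succ] at hab ⊢
            omega
      · by_cases hb : b = i.succ.castSucc
        · rw [hb] at hab ⊢
          refine le_trans (h1 _ _ ha ?_ ?_) h7
          · simp [Fin.ext_iff]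
          · have : a.val ≠ i.val + 1 := fun h => ha (Fin.ext (by simpa using h))
            simp only [Fin.le_def, Fin.val_castSucc, Fin.val_succ] at hab ⊢
            omega
        · exact h1 _ _ ha hb hab
    · intro a
      by_cases ha : a = i.succ.castSucc
      · rw [ha]; exact h9
      · exact h4 a ha
    · intro j
      by_cases hj : j = i.castSucc
      · rw [hj, Fin.succ_castSucc]; exact h10
      · by_cases hj' : j = i.succ
        · rw [hj']; omega
        · exact h5 j hj hj'

theorem flagC_update {m : ℕ} (Δ : Matrix (Fin n) (Fin n) F) (α : Fin (m + 1) → ℕ) (i : Fin m)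
    (W : Fin (m + 2) → Submodule F (Fin n → F)) (U : Submodule F (Fin n → F)) :
    FlagC Δ α i (Function.update W i.succ.castSucc U) ↔ FlagC Δ α i W := by
  have hu : ∀ a, a ≠ i.succ.castSucc → Function.update W i.succ.castSucc U a = W a :=
    fun a ha => Function.update_of_ne ha _ _
  have h0 : (0 : Fin (m + 2)) ≠ i.succ.castSucc := by simp [Fin.ext_iff]
  have hl : Fin.last (m + 1) ≠ i.succ.castSucc := by
    have := i.2
    simp [Fin.ext_iff]; omega
  have hA : i.castSucc.castSucc ≠ i.succ.castSucc := by simp [Fin.ext_iff]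
  have hB : i.succ.succ ≠ i.succ.castSucc := by simp [Fin.ext_iff]
  unfold FlagC
  rw [hu _ h0, hu _ hl, hu _ hA, hu _ hB]
  refine and_congr ?_ (and_congr_right fun _ => and_congr_right fun _ => and_congr ?_
    (and_congr ?_ Iff.rfl))
  · refine forall_congr' fun a => forall_congr' fun b => ?_
    refine imp_congr_right fun ha => imp_congr_right fun hb => ?_
    rw [hu _ ha, hu _ hb]
  · refine forall_congr' fun a => imp_congr_right fun ha => ?_
    rw [hu _ ha]
  · refine forall_congr' fun j => imp_congr_right fun hj => imp_congr_right fun hj' => ?_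
    rw [hu, hu]
    · intro h; exact hj' (Fin.castSucc_injective _ h)
    · rw [← Fin.succ_castSucc]; intro h; exact hj (Fin.succ_injective _ h)

theorem Xflag_swap {m : ℕ} (Δ : Matrix (Fin n) (Fin n) F) (α : Fin (m + 1) → ℕ) (i : Fin m) :
    Xflag Δ (α ∘ Equiv.swap i.castSucc i.succ) = Xflag Δ α := by
  set β := α ∘ Equiv.swap i.castSucc i.succ with hβ
  have : Fintype {W : Fin (m + 2) → Submodule F (Fin n → F) // W i.succ.castSucc = ⊥} :=
    Fintype.ofFinite _
  change Nat.card {W // FlagP Δ β W} = Nat.card {W // FlagP Δ α W}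
  rw [card_fib i.succ.castSucc ⊥, card_fib i.succ.castSucc ⊥]
  refine Finset.sum_congr rfl fun W' _ => ?_
  have hA : i.castSucc.castSucc ≠ i.succ.castSucc := by simp [Fin.ext_iff]
  have hB : i.succ.succ ≠ i.succ.castSucc := by simp [Fin.ext_iff]
  have hP : ∀ (γ : Fin (m + 1) → ℕ) (U : Submodule F (Fin n → F)),
      FlagP Δ γ (Function.update W'.1 i.succ.castSucc U) ↔ FlagC Δ γ i W'.1 ∧
      ((W'.1 i.castSucc.castSucc ≤ U ∧ U ≤ W'.1 i.succ.succ) ∧ U.map Δ.mulVecLin ≤ U ∧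
        finrank F U = finrank F (W'.1 i.castSucc.castSucc) + γ i.castSucc) := by
    intro γ U
    rw [flagP_iff Δ γ i, flagC_update, Function.update_self, Function.update_of_ne hA,
      Function.update_of_ne hB]
  simp only [hP]
  have b1 : β i.castSucc = α i.succ := by simp [hβ]
  have b2 : β i.succ = α i.castSucc := by simp [hβ]
  have hC : FlagC Δ β i W'.1 ↔ FlagC Δ α i W'.1 := by
    unfold FlagC
    rw [b1, b2, add_right_comm (finrank F (W'.1 i.castSucc.castSucc)) (α i.succ)]
    refine and_congr_right fun _ => and_congr_right fun _ => and_congr_right fun _ =>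
      and_congr_right fun _ => and_congr ?_ Iff.rfl
    refine forall_congr' fun j => imp_congr_right fun hj => imp_congr_right fun hj' => ?_
    have : β j = α j := by simp [hβ, Equiv.swap_apply_of_ne_of_ne hj hj']
    rw [this]
  rw [b1]
  simp only [hC]
  by_cases hc : FlagC Δ α i W'.1
  · simp only [hc, true_and]
    obtain ⟨h1, h2, h3, h4, h5, h6⟩ := hc
    refine card_inv_between_symm Δ.mulVecLin _ _ (h1 _ _ hA hB ?_) (h4 _ hA) (h4 _ hB) _ _ ?_
    · simp only [Fin.le_def, Fin.val_castSucc, Fin.val_succ]; omega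
    · omega
  · simp [hc]

theorem Xflag_perm {ℓ : ℕ} (Δ : Matrix (Fin n) (Fin n) F) (α : Fin ℓ → ℕ)
    (π : Equiv.Perm (Fin ℓ)) : Xflag Δ (α ∘ π) = Xflag Δ α := by
  cases ℓ with
  | zero => congr 1; funext i; exact i.elim0
  | succ m =>
    have h : π ∈ Submonoid.closure
        (Set.range fun i : Fin m => Equiv.swap i.castSucc i.succ) := by
      rw [Equiv.Perm.mclosure_swap_castSucc_succ]; trivial
    induction h using Submonoid.closure_induction generalizing α with
    | mem x hx => obtain ⟨i, rfl⟩ := hx; exact Xflag_swap Δ α i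
    | one => rfl
    | mul x y _ _ hx hy =>
      have : α ∘ (x * y : Equiv.Perm (Fin (m + 1))) = (α ∘ x) ∘ y := rfl
      rw [this, hy, hx]

end FlagPerm


section GoodFunctions

set_option linter.unusedSectionVars false

theorem ptn_antitone (l : ℕ →₀ ℕ) (hl : IsPtn l) : Antitone l := antitone_nat_of_succ_le hl

theorem ptn_zero_of_ge (n : ℕ) (l : ℕ →₀ ℕ) (hl : IsPtn l) (hs : ptnSize l = n) (i : ℕ)
    (hi : n ≤ i) : l i = 0 := by
  by_contra hne
  have hsub : Finset.range (i + 1) ⊆ l.support := by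
    intro j hj
    have := ptn_antitone l hl (Nat.lt_succ_iff.1 (Finset.mem_range.1 hj))
    rw [Finsupp.mem_support_iff]
    omega
  have h1 : ∑ j ∈ Finset.range (i + 1), 1 ≤ ptnSize l := by
    unfold ptnSize Finsupp.sum
    calc ∑ j ∈ Finset.range (i + 1), 1 ≤ ∑ j ∈ l.support, 1 :=
          Finset.sum_le_sum_of_subset hsub
      _ ≤ _ := Finset.sum_le_sum fun j hj => by
          have := Finsupp.mem_support_iff.1 hj
          exact Nat.one_le_iff_ne_zero.2 this
  simp at h1
  omega

theorem ptn_le (n : ℕ) (l : ℕ →₀ ℕ) (hs : ptnSize l = n) (i : ℕ) : l i ≤ n := by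
  by_cases hi : i ∈ l.support
  · rw [← hs]
    exact Finset.single_le_sum (f := fun j => l j) (fun _ _ => Nat.zero_le _) hi
  · rw [Finsupp.notMem_support_iff.1 hi]; exact Nat.zero_le _

theorem finite_ptn (n : ℕ) : {l : ℕ →₀ ℕ | IsPtn l ∧ ptnSize l = n}.Finite := by
  have : Finite ({l : ℕ →₀ ℕ | IsPtn l ∧ ptnSize l = n}) := by
    refine Finite.of_injective
      (fun l => (fun i => ⟨l.1 i, Nat.lt_succ_of_le (ptn_le n l.1 l.2.2 i)⟩ :
        Fin n → Fin (n + 1))) ?_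
    intro l l' h
    apply Subtype.ext
    ext i
    by_cases hi : i < n
    · exact congrArg Fin.val (congrFun h ⟨i, hi⟩)
    · rw [ptn_zero_of_ge n l.1 l.2.1 l.2.2 i (by omega),
        ptn_zero_of_ge n l'.1 l'.2.1 l'.2.2 i (by omega)]
  exact Set.toFinite _

/-- Functions of `(F, Δ)` that are integral polynomial combinations of flag counts. -/
def Good (n : ℕ) (Φ : ∀ (F : Type) [Field F] [Fintype F], Matrix (Fin n) (Fin n) F → ℤ) : Prop :=
  ∃ g : (ℕ →₀ ℕ) → Polynomial ℤ, ∀ (F : Type) [Field F] [Fintype F]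
    (Δ : Matrix (Fin n) (Fin n) F), Φ F Δ =
      ∑ᶠ l ∈ {l : ℕ →₀ ℕ | IsPtn l ∧ ptnSize l = n},
        (g l).eval (Fintype.card F : ℤ) * (Xflag Δ (fun i : Fin n => l i) : ℤ)

theorem Good.congr {n : ℕ} {Φ Ψ : ∀ (F : Type) [Field F] [Fintype F],
    Matrix (Fin n) (Fin n) F → ℤ} (h : Good n Φ)
    (e : ∀ (F : Type) [Field F] [Fintype F] (Δ : Matrix (Fin n) (Fin n) F), Ψ F Δ = Φ F Δ) :
    Good n Ψ := by
  obtain ⟨g, hg⟩ := h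
  exact ⟨g, fun F _ _ Δ => (e F Δ).trans (hg F Δ)⟩

theorem Good.zero (n : ℕ) : Good n (fun _ _ _ _ => 0) :=
  ⟨0, fun F _ _ Δ => by simp⟩

theorem Good.add {n : ℕ} {Φ Ψ : ∀ (F : Type) [Field F] [Fintype F],
    Matrix (Fin n) (Fin n) F → ℤ} (h : Good n Φ) (h' : Good n Ψ) :
    Good n (fun F _ _ Δ => Φ F Δ + Ψ F Δ) := by
  obtain ⟨g, hg⟩ := h
  obtain ⟨g', hg'⟩ := h'
  refine ⟨g + g', fun F _ _ Δ => ?_⟩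
  show Φ F Δ + Ψ F Δ = _
  rw [hg, hg', ← finsum_mem_add_distrib (finite_ptn n)]
  refine finsum_mem_congr rfl fun l _ => ?_
  simp only [Pi.add_apply, eval_add]
  ring

theorem Good.smul {n : ℕ} {Φ : ∀ (F : Type) [Field F] [Fintype F],
    Matrix (Fin n) (Fin n) F → ℤ} (h : Good n Φ) (c : Polynomial ℤ) :
    Good n (fun F _ _ Δ => c.eval (Fintype.card F : ℤ) * Φ F Δ) := by
  obtain ⟨g, hg⟩ := h
  refine ⟨fun l => c * g l, fun F _ _ Δ => ?_⟩
  show c.eval (Fintype.card F : ℤ) * Φ F Δ = _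
  rw [hg, finsum_mem_eq_finite_toFinset_sum _ (finite_ptn n),
    finsum_mem_eq_finite_toFinset_sum _ (finite_ptn n), Finset.mul_sum]
  refine Finset.sum_congr rfl fun l _ => ?_
  simp only [eval_mul]
  ring

theorem Good.sub {n : ℕ} {Φ Ψ : ∀ (F : Type) [Field F] [Fintype F],
    Matrix (Fin n) (Fin n) F → ℤ} (h : Good n Φ) (h' : Good n Ψ) :
    Good n (fun F _ _ Δ => Φ F Δ - Ψ F Δ) :=
  (h.add (h'.smul (-1))).congr fun F _ _ Δ => by simp [sub_eq_add_neg]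

theorem Good.sum {n : ℕ} {ι : Type} (s : Finset ι) (Φ : ι → ∀ (F : Type) [Field F] [Fintype F],
    Matrix (Fin n) (Fin n) F → ℤ) (h : ∀ i ∈ s, Good n (Φ i)) :
    Good n (fun F _ _ Δ => ∑ i ∈ s, Φ i F Δ) := by
  induction s using Finset.induction_on with
  | empty => exact (Good.zero n).congr fun F _ _ Δ => by simp
  | insert a s ha ih =>
    refine ((h a (by simp)).add (ih fun i hi => h i (by simp [hi]))).congr fun F _ _ Δ => ?_
    rw [Finset.sum_insert ha]

theorem Good.flag (n : ℕ) (α : Fin n → ℕ) (hα : ∑ i, α i = n) :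
    Good n (fun F _ _ Δ => (Xflag Δ α : ℤ)) := by
  obtain ⟨π, hπ⟩ : ∃ π : Equiv.Perm (Fin n), Antitone (α ∘ π) :=
    ⟨Tuple.sort (OrderDual.toDual ∘ α), Tuple.monotone_sort (OrderDual.toDual ∘ α)⟩
  set β := α ∘ π with hβ
  let b : ℕ → ℕ := fun i => if h : i < n then β ⟨i, h⟩ else 0
  let l : ℕ →₀ ℕ := Finsupp.onFinset (Finset.range n) b (fun i hi => by
    by_contra hcon
    exact hi (dif_neg (by simpa using hcon)))
  have hl : ∀ i, l i = b i := fun i => rfl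
  have hl1 : IsPtn l := by
    intro i
    rw [hl, hl]
    simp only [b]
    by_cases h : i + 1 < n
    · rw [dif_pos h, dif_pos (by omega)]
      exact hπ (by simp [Fin.le_def])
    · rw [dif_neg h]; exact Nat.zero_le _
  have hl2 : ptnSize l = n := by
    unfold ptnSize
    rw [Finsupp.onFinset_sum _ (by simp), Finset.sum_range]
    calc ∑ i : Fin n, b i = ∑ i : Fin n, α (π i) :=
          Finset.sum_congr rfl fun i _ => by simp [b, hβ]
      _ = ∑ i, α i := Equiv.sum_comp π α
      _ = n := hα
  refine ⟨fun l' => if l' = l then 1 else 0, fun F _ _ Δ => ?_⟩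
  have hX : Xflag Δ (fun i : Fin n => l i) = Xflag Δ α := by
    rw [← Xflag_perm Δ α π]
    congr 1
    funext i
    simp [hl, b, hβ]
  rw [finsum_mem_eq_finite_toFinset_sum _ (finite_ptn n), Finset.sum_eq_single l]
  · simp [hX]
  · intro l' _ hne
    simp [hne]
  · intro h
    exact absurd ((Set.Finite.mem_toFinset (finite_ptn n)).2 ⟨hl1, hl2⟩) h

end GoodFunctions


section BaseCase

set_option linter.unusedSectionVars false

/-- Generalised flags indexed by dimensions in `D`, with `Δ V_x ⊆ V_{h x}` and, for `i ∈ Ex`,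
the exactness condition `V_{h i} ⊆ V_i + Δ V_i`. -/
def FP {F : Type} [Field F] {n : ℕ} (D : Finset (Fin (n + 1))) (h : Fin (n + 1) → Fin (n + 1))
    (Ex : Finset (Fin (n + 1))) (Δ : Matrix (Fin n) (Fin n) F)
    (V : Fin (n + 1) → Submodule F (Fin n → F)) : Prop :=
  (∀ x, x ∉ D → V x = ⊥) ∧ (∀ x ∈ D, finrank F (V x) = (x : ℕ)) ∧
    (∀ x ∈ D, ∀ y ∈ D, x ≤ y → V x ≤ V y) ∧
    (∀ x ∈ D, (V x).map Δ.mulVecLin ≤ V (h x)) ∧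
    (∀ i ∈ Ex, V (h i) ≤ V i ⊔ (V i).map Δ.mulVecLin)

/-- The number of generalised flags. -/
noncomputable def cnt {n : ℕ} (D : Finset (Fin (n + 1))) (h : Fin (n + 1) → Fin (n + 1))
    (Ex : Finset (Fin (n + 1))) (F : Type) [Field F] [Fintype F]
    (Δ : Matrix (Fin n) (Fin n) F) : ℤ :=
  (Nat.card {V : Fin (n + 1) → Submodule F (Fin n → F) // FP D h Ex Δ V} : ℤ)

/-- Admissible index data. -/
structure Valid {n : ℕ} (D : Finset (Fin (n + 1))) (h : Fin (n + 1) → Fin (n + 1)) : Prop where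
  zero_mem : 0 ∈ D
  last_mem : Fin.last n ∈ D
  h_zero : h 0 = 0
  h_mem : ∀ x ∈ D, h x ∈ D
  le_h : ∀ x ∈ D, x ≤ h x
  mono : ∀ x ∈ D, ∀ y ∈ D, x ≤ y → h x ≤ h y

theorem exists_ceil {n : ℕ} (D : Finset (Fin (n + 1))) (hl : Fin.last n ∈ D) :
    ∃ c : Fin (n + 1) → Fin (n + 1), (∀ x, c x ∈ D) ∧ (∀ x, x ≤ c x) ∧
      (∀ x, ∀ d ∈ D, x ≤ d → c x ≤ d) := by
  have : ∀ x : Fin (n + 1), ∃ c ∈ D, x ≤ c ∧ ∀ d ∈ D, x ≤ d → c ≤ d := by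
    intro x
    have hne : (D.filter (fun d => x ≤ d)).Nonempty := ⟨Fin.last n, by simp [hl, Fin.le_last]⟩
    refine ⟨(D.filter (fun d => x ≤ d)).min' hne, ?_, ?_, ?_⟩
    · exact (Finset.mem_filter.1 (Finset.min'_mem _ hne)).1
    · exact (Finset.mem_filter.1 (Finset.min'_mem _ hne)).2
    · intro d hd hx
      exact Finset.min'_le _ _ (Finset.mem_filter.2 ⟨hd, hx⟩)
  choose c h1 h2 h3 using this
  exact ⟨c, h1, h2, h3⟩

theorem good_base {n : ℕ} (D : Finset (Fin (n + 1))) (h : Fin (n + 1) → Fin (n + 1))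
    (hv : Valid D h) (hi : ∀ x ∈ D, h x = x) : Good n (cnt D h ∅) := by
  obtain ⟨c, c1, c2, c3⟩ := exists_ceil D hv.last_mem
  have cmono : Monotone c := fun x y hxy => c3 x _ (c1 y) (hxy.trans (c2 y))
  have cD : ∀ x ∈ D, c x = x := fun x hx => le_antisymm (c3 x x hx le_rfl) (c2 x)
  have c0 : c 0 = 0 := cD 0 hv.zero_mem
  have cl : c (Fin.last n) = Fin.last n := cD _ hv.last_mem
  let α : Fin n → ℕ := fun i => (c i.succ : ℕ) - (c i.castSucc : ℕ)
  have hα' : ∀ i : Fin n, (c i.castSucc : ℕ) + α i = (c i.succ : ℕ) := fun i => by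
    have : c i.castSucc ≤ c i.succ := cmono (Fin.castSucc_le_succ i)
    simp only [α]
    rw [Fin.le_def] at this
    omega
  have hα : ∑ i, α i = n := by
    let f : ℕ → ℕ := fun i => if hi : i < n + 1 then (c ⟨i, hi⟩ : ℕ) else n
    have hf : Monotone f := by
      intro a b hab
      simp only [f]
      by_cases hb : b < n + 1
      · rw [dif_pos hb, dif_pos (by omega)]
        exact cmono (by simpa [Fin.le_def] using hab)
      · rw [dif_neg hb]
        split_ifs with ha
        · exact Nat.lt_succ_iff.1 (c ⟨a, ha⟩).2
        · exact le_rfl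
    have := Finset.sum_range_tsub hf n
    rw [Finset.sum_range] at this
    have e : ∀ i : Fin n, f (i + 1) - f i = α i := by
      intro i
      have h1 := i.2
      simp only [f, α]
      rw [dif_pos (by omega), dif_pos (by omega)]
      rfl
    simp only [e] at this
    rw [this]
    have f0 : f 0 = 0 := by
      simp only [f]; rw [dif_pos (by omega)]
      exact congrArg Fin.val c0
    have fn : f n = n := by
      simp only [f]; rw [dif_pos (by omega)]
      exact congrArg Fin.val cl
    rw [f0, fn]; rfl
  refine (Good.flag n α hα).congr fun F _ _ Δ => ?_
  unfold cnt Xflag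
  congr 1
  have hrank : ∀ W : Fin (n + 1) → Submodule F (Fin n → F), W 0 = ⊥ →
      (∀ i : Fin n, finrank F (W i.succ) = finrank F (W i.castSucc) + α i) →
      ∀ x, finrank F (W x) = (c x : ℕ) := by
    intro W h0 hs x
    induction x using Fin.induction with
    | zero => rw [h0, c0]; simp
    | succ i ih => rw [hs, ih, hα']
  refine Nat.card_congr
    { toFun := fun V => ⟨fun x => V.1 (c x), ?_⟩
      invFun := fun W => ⟨fun x => if x ∈ D then W.1 x else ⊥, ?_⟩
      left_inv := ?_
      right_inv := ?_ }
  · obtain ⟨V, v1, v2, v3, v4, v5⟩ := V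
    refine ⟨fun x y hxy => v3 _ (c1 x) _ (c1 y) (cmono hxy), ?_, ?_, ?_, ?_⟩
    · show V (c 0) = ⊥
      rw [← Submodule.finrank_eq_zero (R := F), v2 _ (c1 0), c0]; rfl
    · show V (c (Fin.last n)) = ⊤
      apply Submodule.eq_top_of_finrank_eq
      rw [v2 _ (c1 _), cl]; simp
    · intro x
      have := v4 _ (c1 x)
      rwa [hi _ (c1 x)] at this
    · intro i
      show finrank F (V (c i.succ)) = finrank F (V (c i.castSucc)) + α i
      rw [v2 _ (c1 _), v2 _ (c1 _), hα']
  · obtain ⟨W, w1, w2, w3, w4, w5⟩ := W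
    have hr := hrank W w2 w5
    refine ⟨fun x hx => if_neg hx, fun x hx => ?_, fun x hx y hy hxy => ?_, fun x hx => ?_, ?_⟩
    · show finrank F ↥(if x ∈ D then W x else ⊥) = _
      rw [if_pos hx, hr, cD x hx]
    · simp only [if_pos hx, if_pos hy]
      exact w1 hxy
    · simp only [if_pos hx, hi x hx]
      exact w4 x
    · simp
  · rintro ⟨V, v1, v2, v3, v4, v5⟩
    apply Subtype.ext
    funext x
    by_cases hx : x ∈ D
    · simp [hx, cD x hx]
    · simp [hx, v1 x hx]
  · rintro ⟨W, w1, w2, w3, w4, w5⟩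
    apply Subtype.ext
    funext x
    have hr := hrank W w2 w5
    show (if c x ∈ D then W (c x) else ⊥) = W x
    rw [if_pos (c1 x)]
    refine (Submodule.eq_of_le_of_finrank_eq (w1 (c2 x)) ?_).symm
    rw [hr, hr, cD _ (c1 x)]

end BaseCase


section Insertion

set_option linter.unusedSectionVars false

theorem exists_unimod (g : ℕ → ℤ[X]) (N : ℕ) :
    ∃ c : ℕ → ℤ[X], ∀ m < N, g m = ∑ a ∈ Finset.range N, c a * qbp m a := by
  induction N with
  | zero => exact ⟨0, by simp⟩
  | succ N ih =>
    obtain ⟨c, hc⟩ := ih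
    let c' : ℕ → ℤ[X] := fun k =>
      if k = N then g N - ∑ a ∈ Finset.range N, c a * qbp N a else c k
    have e : ∀ m, ∑ a ∈ Finset.range N, c' a * qbp m a = ∑ a ∈ Finset.range N, c a * qbp m a :=
      fun m => Finset.sum_congr rfl fun a ha => by
        have := Finset.mem_range.1 ha
        simp only [c']; rw [if_neg (by omega)]
    refine ⟨c', fun m hm => ?_⟩
    rw [Finset.sum_range_succ, e]
    by_cases h : m = N
    · subst h
      simp only [c', if_true, qbp_self]
      ring
    · rw [qbp_of_lt m N (by omega), hc m (by omega)]
      ring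

theorem rank_rel {F : Type} [Field F] [Fintype F] {V : Type} [AddCommGroup V] [Module F V] [Module.Finite F V]
    (f : V →ₗ[F] V) (A B : Submodule F V) :
    finrank F ↥(A ⊔ B.map f) + finrank F ↥(B ⊓ A.comap f) = finrank F A + finrank F B := by
  have h1 := finrank_map_add_inf (A.mkQ.comp f) B
  have h2 := finrank_map_add_inf A.mkQ (A ⊔ B.map f)
  have h3 : (A ⊔ B.map f).map A.mkQ = B.map (A.mkQ.comp f) := by
    rw [Submodule.map_sup, Submodule.map_comp, Submodule.mkQ_map_self, bot_sup_eq]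
  have h4 : LinearMap.ker (A.mkQ.comp f) = A.comap f := by
    rw [LinearMap.ker_comp, Submodule.ker_mkQ]
  rw [h4] at h1
  rw [h3, Submodule.ker_mkQ, inf_eq_right.2 le_sup_left] at h2
  omega

theorem card_fib_int {I Y : Type} [DecidableEq I] [Finite I] [Finite Y] (x : I) (y0 : Y)
    (P C : (I → Y) → Prop) (Q : (I → Y) → Y → Prop) (hC : ∀ W, C W → W x = y0)
    (hPQ : ∀ W, W x = y0 → ∀ U, (P (Function.update W x U) ↔ C W ∧ Q W U))
    [Fintype {W : I → Y // C W}] :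
    (Nat.card {W : I → Y // P W} : ℤ) = ∑ W : {W : I → Y // C W},
      (Nat.card {U : Y // Q W.1 U} : ℤ) := by
  rw [← Nat.cast_sum, ← Nat.card_sigma]
  have key : ∀ V, P V ↔ C (Function.update V x y0) ∧ Q (Function.update V x y0) (V x) := by
    intro V
    rw [← hPQ _ (by simp)]
    simp
  congr 1
  refine Nat.card_congr
    { toFun := fun W => ⟨⟨Function.update W.1 x y0, ((key W.1).1 W.2).1⟩,
        ⟨W.1 x, ((key W.1).1 W.2).2⟩⟩
      invFun := fun p => ⟨Function.update p.1.1 x p.2.1,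
        (hPQ _ (hC _ p.1.2) _).2 ⟨p.1.2, p.2.2⟩⟩
      left_inv := fun W => by simp
      right_inv := ?_ }
  rintro ⟨⟨W, hW⟩, ⟨U, hU⟩⟩
  have h1 : Function.update (Function.update W x U) x y0 = W := by
    have := hC W hW
    subst this; simp
  have gen : ∀ (P1 P2 : {W : I → Y // C W}) (_ : P1 = P2)
      (s : {U : Y // Q P1.1 U}) (t : {U : Y // Q P2.1 U}),
      s.1 = t.1 → (⟨P1, s⟩ : Σ W' : {W : I → Y // C W}, {U : Y // Q W'.1 U}) = ⟨P2, t⟩ := by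
    rintro P1 _ rfl s t h
    congr 1
    exact Subtype.ext h
  exact gen _ _ (Subtype.ext h1) _ _ (by simp)

variable {n : ℕ}

theorem FP_congr {F : Type} [Field F] (D Ex : Finset (Fin (n + 1)))
    (h h' : Fin (n + 1) → Fin (n + 1))
    (hE : Ex ⊆ D) (hh : ∀ x ∈ D, h x = h' x) (Δ : Matrix (Fin n) (Fin n) F)
    (V : Fin (n + 1) → Submodule F (Fin n → F)) : FP D h Ex Δ V ↔ FP D h' Ex Δ V := by
  unfold FP
  refine and_congr Iff.rfl (and_congr Iff.rfl (and_congr Iff.rfl (and_congr ?_ ?_)))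
  · exact forall₂_congr fun x hx => by rw [hh x hx]
  · exact forall₂_congr fun x hx => by rw [hh x (hE hx)]

/-- Redirect the arrows to `p` towards `pp`. -/
noncomputable def hcut (p pp : Fin (n + 1)) (h : Fin (n + 1) → Fin (n + 1)) :
    Fin (n + 1) → Fin (n + 1) := fun x => if h x = p then pp else h x

/-- `pm < p < pp` are consecutive in `insert p D`. -/
structure Nbr (D : Finset (Fin (n + 1))) (pm p pp : Fin (n + 1)) : Prop where
  pm_mem : pm ∈ D
  pp_mem : pp ∈ D
  pm_lt : pm < p
  lt_pp : p < pp
  nmem : p ∉ D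
  split : ∀ d ∈ D, d ≤ pm ∨ pp ≤ d

theorem FP_insert {F : Type} [Field F] (D : Finset (Fin (n + 1)))
    (h : Fin (n + 1) → Fin (n + 1)) (pm p pp : Fin (n + 1)) (hN : Nbr D pm p pp)
    (hp : h p ≠ p) (Δ : Matrix (Fin n) (Fin n) F)
    (W : Fin (n + 1) → Submodule F (Fin n → F)) (hW : W p = ⊥) (U : Submodule F (Fin n → F)) :
    FP (insert p D) h ∅ Δ (Function.update W p U) ↔ FP D (hcut p pp h) ∅ Δ W ∧
      (finrank F U = (p : ℕ) ∧ W pm ≤ U ∧ U ≤ W pp ∧ U.map Δ.mulVecLin ≤ W (h p) ∧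
        ∀ x ∈ D, h x = p → (W x).map Δ.mulVecLin ≤ U) := by
  obtain ⟨hpm, hpp, l1, l2, hpD, hsp⟩ := hN
  have up : Function.update W p U p = U := Function.update_self ..
  have un : ∀ x, x ≠ p → Function.update W p U x = W x := fun x hx =>
    Function.update_of_ne hx ..
  have hD : ∀ x ∈ D, x ≠ p := fun x hx e => hpD (e ▸ hx)
  constructor
  · rintro ⟨v1, v2, v3, v4, -⟩
    have i1 : ∀ x ∈ D, x ∈ insert p D := fun x hx => Finset.mem_insert_of_mem hx
    have i2 : p ∈ insert p D := Finset.mem_insert_self _ _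
    have a1 : U ≤ W pp := by
      have := v3 p i2 pp (i1 _ hpp) l2.le
      rwa [up, un pp (hD _ hpp)] at this
    have a2 : W pm ≤ U := by
      have := v3 pm (i1 _ hpm) p i2 l1.le
      rwa [up, un pm (hD _ hpm)] at this
    have a3 : ∀ x ∈ D, h x = p → (W x).map Δ.mulVecLin ≤ U := by
      intro x hx hxp
      have := v4 x (i1 _ hx)
      rwa [hxp, up, un x (hD _ hx)] at this
    refine ⟨⟨?_, ?_, ?_, ?_, by simp⟩, ?_, a2, a1, ?_, a3⟩
    · intro x hx
      by_cases hxp : x = p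
      · rw [hxp, hW]
      · have := v1 x (by simp [hxp, hx])
        rwa [un x hxp] at this
    · intro x hx
      have := v2 x (i1 _ hx)
      rwa [un x (hD _ hx)] at this
    · intro x hx y hy hxy
      have := v3 x (i1 _ hx) y (i1 _ hy) hxy
      rwa [un x (hD _ hx), un y (hD _ hy)] at this
    · intro x hx
      unfold hcut
      split_ifs with hxp
      · exact (a3 x hx hxp).trans a1
      · have := v4 x (i1 _ hx)
        rwa [un x (hD _ hx), un _ hxp] at this
    · have := v2 p i2
      rwa [up] at this
    · have := v4 p i2
      rwa [up, un _ hp] at this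
  · rintro ⟨⟨w1, w2, w3, w4, -⟩, b1, b2, b3, b4, b5⟩
    refine ⟨?_, ?_, ?_, ?_, by simp⟩
    · intro x hx
      rw [Finset.mem_insert, not_or] at hx
      rw [un x hx.1, w1 x hx.2]
    · intro x hx
      rcases Finset.mem_insert.1 hx with rfl | hx
      · rw [up, b1]
      · rw [un x (hD _ hx), w2 x hx]
    · intro x hx y hy hxy
      rcases Finset.mem_insert.1 hx with rfl | hx2
      · rcases Finset.mem_insert.1 hy with rfl | hy
        · exact le_rfl
        · rw [up, un y (hD _ hy)]
          rcases hsp y hy with hy' | hy'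
          · exact absurd (hxy.trans hy') (not_le.2 l1)
          · exact b3.trans (w3 _ hpp _ hy hy')
      · rcases Finset.mem_insert.1 hy with rfl | hy
        · rw [up, un x (hD _ hx2)]
          rcases hsp x hx2 with hx' | hx'
          · exact (w3 _ hx2 _ hpm hx').trans b2
          · exact absurd (hx'.trans hxy) (not_le.2 l2)
        · rw [un x (hD _ hx2), un y (hD _ hy)]
          exact w3 x hx2 y hy hxy
    · intro x hx
      rcases Finset.mem_insert.1 hx with rfl | hx
      · rw [up, un _ hp]; exact b4
      · rw [un x (hD _ hx)]
        by_cases hxp : h x = p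
        · rw [hxp, up]; exact b5 x hx hxp
        · rw [un _ hxp]
          have := w4 x hx
          unfold hcut at this
          rwa [if_neg hxp] at this

theorem cnt_insert (D : Finset (Fin (n + 1)))
    (h h2 : Fin (n + 1) → Fin (n + 1)) (pm p pp : Fin (n + 1)) (hN : Nbr D pm p pp)
    (hp : h p ≠ p) (hh2 : ∀ x ∈ D, hcut p pp h x = h2 x)
    (F : Type) [Field F] [Fintype F] (Δ : Matrix (Fin n) (Fin n) F)
    [Fintype {W : Fin (n + 1) → Submodule F (Fin n → F) // FP D h2 ∅ Δ W}] :
    cnt (insert p D) h ∅ F Δ = ∑ W : {W : Fin (n + 1) → Submodule F (Fin n → F) //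
      FP D h2 ∅ Δ W}, (Nat.card {U : Submodule F (Fin n → F) //
        (finrank F U = (p : ℕ) ∧ W.1 pm ≤ U ∧ U ≤ W.1 pp ∧ U.map Δ.mulVecLin ≤ W.1 (h p) ∧
        ∀ x ∈ D, h x = p → (W.1 x).map Δ.mulVecLin ≤ U)} : ℤ) := by
  unfold cnt
  refine card_fib_int p ⊥ (FP (insert p D) h ∅ Δ) (FP D h2 ∅ Δ)
    (fun W U => finrank F U = (p : ℕ) ∧ W pm ≤ U ∧ U ≤ W pp ∧ U.map Δ.mulVecLin ≤ W (h p) ∧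
        ∀ x ∈ D, h x = p → (W x).map Δ.mulVecLin ≤ U) (fun W hW => hW.1 p hN.nmem)
    (fun W hW U => ?_)
  rw [← FP_congr D ∅ _ _ (by simp) hh2]
  exact FP_insert D h pm p pp hN hp Δ W hW U

end Insertion


section Elimination

set_option linter.unusedSectionVars false

variable {n : ℕ}

theorem exists_pred (D : Finset (Fin (n + 1))) (h0 : 0 ∈ D) (p : Fin (n + 1)) (hp : p ≠ 0) :
    ∃ m ∈ D, m < p ∧ ∀ d ∈ D, d < p → d ≤ m := by
  have hne : (D.filter (fun d => d < p)).Nonempty := ⟨0, by simp [h0, Fin.pos_iff_ne_zero, hp]⟩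
  refine ⟨(D.filter (fun d => d < p)).max' hne, ?_, ?_, ?_⟩
  · exact (Finset.mem_filter.1 (Finset.max'_mem _ hne)).1
  · exact (Finset.mem_filter.1 (Finset.max'_mem _ hne)).2
  · intro d hd hx
    exact Finset.le_max' _ _ (Finset.mem_filter.2 ⟨hd, hx⟩)

theorem exists_next (D : Finset (Fin (n + 1))) (p : Fin (n + 1)) (s : Fin (n + 1)) (hs : s ∈ D)
    (hps : p < s) : ∃ m ∈ D, p < m ∧ ∀ d ∈ D, p < d → m ≤ d := by
  have hne : (D.filter (fun d => p < d)).Nonempty := ⟨s, by simp [hs, hps]⟩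
  refine ⟨(D.filter (fun d => p < d)).min' hne, ?_, ?_, ?_⟩
  · exact (Finset.mem_filter.1 (Finset.min'_mem _ hne)).1
  · exact (Finset.mem_filter.1 (Finset.min'_mem _ hne)).2
  · intro d hd hx
    exact Finset.min'_le _ _ (Finset.mem_filter.2 ⟨hd, hx⟩)

theorem valid_hcut (D : Finset (Fin (n + 1)))
    (h : Fin (n + 1) → Fin (n + 1)) (pm p pp : Fin (n + 1)) (hN : Nbr D pm p pp)
    (hv : Valid (insert p D) h) : Valid D (hcut p pp h) := by
  have hp0 : p ≠ 0 := fun e => by have := hN.pm_lt; rw [e] at this; exact absurd this (by simp)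
  have hpl : p ≠ Fin.last n := fun e => by
    have := hN.lt_pp; rw [e] at this; exact absurd (Fin.le_last pp) (not_le.2 this)
  have i1 : ∀ x ∈ D, x ∈ insert p D := fun x hx => Finset.mem_insert_of_mem hx
  have hm : ∀ x ∈ D, h x ≠ p → h x ∈ D := fun x hx hxp =>
    (Finset.mem_insert.1 (hv.h_mem x (i1 x hx))).resolve_left hxp
  refine ⟨(Finset.mem_insert.1 hv.zero_mem).resolve_left hp0.symm,
    (Finset.mem_insert.1 hv.last_mem).resolve_left hpl.symm, ?_, ?_, ?_, ?_⟩
  · unfold hcut; rw [hv.h_zero, if_neg hp0.symm]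
  · intro x hx
    unfold hcut; split_ifs with e
    · exact hN.pp_mem
    · exact hm x hx e
  · intro x hx
    have := hv.le_h x (i1 x hx)
    unfold hcut; split_ifs with e
    · exact (e ▸ this).trans hN.lt_pp.le
    · exact this
  · intro x hx y hy hxy
    have := hv.mono x (i1 x hx) y (i1 y hy) hxy
    unfold hcut; split_ifs with e1 e2 e2
    · exact le_rfl
    · rw [e1] at this
      rcases hN.split _ (hm y hy e2) with h1 | h1
      · exact absurd (this.trans h1) (not_le.2 hN.pm_lt)
      · exact h1
    · rw [e2] at this
      exact this.trans hN.lt_pp.le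
    · exact this

theorem sum_ins (D : Finset (Fin (n + 1))) (p : Fin (n + 1)) (hp : p ∉ D) :
    ∑ d ∈ insert p D, (d : ℕ) = p + ∑ d ∈ D, (d : ℕ) := Finset.sum_insert hp

theorem elim_nojump (D : Finset (Fin (n + 1)))
    (h : Fin (n + 1) → Fin (n + 1)) (pm p pp : Fin (n + 1)) (hN : Nbr D pm p pp)
    (hp : h p ≠ p) (hpp : h pp = h p) (hno : ∀ j ∈ D, h j ≠ p)
    (IH : Good n (cnt D (hcut p pp h) ∅)) : Good n (cnt (insert p D) h ∅) := by
  refine (IH.smul (qbp ((pp : ℕ) - pm) ((p : ℕ) - pm))).congr fun F _ _ Δ => ?_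
  haveI := Fintype.ofFinite {W : Fin (n + 1) → Submodule F (Fin n → F) //
    FP D (hcut p pp h) ∅ Δ W}
  rw [cnt_insert D h (hcut p pp h) pm p pp hN hp (fun _ _ => rfl)]
  have key : ∀ W : {W : Fin (n + 1) → Submodule F (Fin n → F) // FP D (hcut p pp h) ∅ Δ W},
      (Nat.card {U : Submodule F (Fin n → F) //
        (finrank F U = (p : ℕ) ∧ W.1 pm ≤ U ∧ U ≤ W.1 pp ∧ U.map Δ.mulVecLin ≤ W.1 (h p) ∧
        ∀ x ∈ D, h x = p → (W.1 x).map Δ.mulVecLin ≤ U)} : ℤ) =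
      (qbp ((pp : ℕ) - pm) ((p : ℕ) - pm)).eval (Fintype.card F : ℤ) := by
    rintro ⟨W, w1, w2, w3, w4, w5⟩
    have hrm := w2 pm hN.pm_mem
    have hrp := w2 pp hN.pp_mem
    have hd := w4 pp hN.pp_mem
    have e : hcut p pp h pp = h p := by
      unfold hcut; rw [if_neg (hpp ▸ hp), hpp]
    rw [e] at hd
    have := card_between (W pm) (W pp) (w3 _ hN.pm_mem _ hN.pp_mem (hN.pm_lt.trans hN.lt_pp).le)
      (p : ℕ) (by rw [hrm]; exact hN.pm_lt.le)
    rw [hrm, hrp] at this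
    rw [← this]
    congr 1
    refine Nat.card_congr (Equiv.subtypeEquivRight fun U => ?_)
    constructor
    · rintro ⟨a, b, c, -⟩
      exact ⟨a, b, c⟩
    · rintro ⟨a, b, c⟩
      exact ⟨a, b, c, (Submodule.map_mono c).trans hd, fun x hx e => absurd e (hno x hx)⟩
  rw [Finset.sum_congr rfl fun W _ => key W]
  unfold cnt
  rw [Nat.card_eq_fintype_card]
  simp [mul_comm]

/-- The relative dimension of `V_j ∩ Δ⁻¹ V_pm` over `V_jm`. -/
noncomputable def mdim {F : Type} [Field F] (jm j pm : Fin (n + 1)) (Δ : Matrix (Fin n) (Fin n) F)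
    (W : Fin (n + 1) → Submodule F (Fin n → F)) : ℕ :=
  finrank F ↥(W j ⊓ (W pm).comap Δ.mulVecLin) - (jm : ℕ)

theorem elim_target (D : Finset (Fin (n + 1)))
    (h : Fin (n + 1) → Fin (n + 1)) (jm j pm : Fin (n + 1)) (hv : Valid D h)
    (hjm : jm ∈ D) (hj : j ∈ D) (hpm : pm ∈ D) (hlt : jm < j) (hpred : ∀ d ∈ D, d < j → d ≤ jm)
    (hjp : j ≤ pm) (h1 : h jm ≤ pm) (h2 : pm < h j) (a : ℕ) (ha : a ≤ (j : ℕ) - jm) :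
    ∃ D1 h1, Valid D1 h1 ∧ ∑ d ∈ D1, (d : ℕ) ≤ (∑ d ∈ D, (d : ℕ)) + pm ∧
      ∀ (F : Type) [Field F] [Fintype F] (Δ : Matrix (Fin n) (Fin n) F)
        [Fintype {W : Fin (n + 1) → Submodule F (Fin n → F) // FP D h ∅ Δ W}],
        cnt D1 h1 ∅ F Δ = ∑ W : {W : Fin (n + 1) → Submodule F (Fin n → F) // FP D h ∅ Δ W},
          (qbp (mdim jm j pm Δ W.1) a).eval (Fintype.card F : ℤ) := by
  have hlt' : (jm : ℕ) < j := hlt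
  have hjp' : (j : ℕ) ≤ pm := hjp
  have hle : ∀ x ∈ D, x < j → h x ≤ pm := fun x hx hxj =>
    (hv.mono x hx jm hjm (hpred x hx hxj)).trans h1
  have hge : ∀ x ∈ D, j ≤ x → pm < h x := fun x hx hxj => h2.trans_le (hv.mono j hj x hx hxj)
  have hj0 : j ≠ 0 := fun e => by rw [e] at hlt; exact absurd hlt (by simp)
  rcases Nat.eq_zero_or_pos a with rfl | ha0
  · refine ⟨D, h, hv, by omega, fun F _ _ Δ _ => ?_⟩
    unfold cnt
    rw [Nat.card_eq_fintype_card]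
    simp [qbp_zero_right]
  · rcases eq_or_lt_of_le ha with rfl | ha1
    · refine ⟨D, Function.update h j pm, ?_, by omega, fun F _ _ Δ _ => ?_⟩
      · have un : ∀ x, x ≠ j → Function.update h j pm x = h x := fun x hx =>
          Function.update_of_ne hx ..
        refine ⟨hv.zero_mem, hv.last_mem, ?_, ?_, ?_, ?_⟩
        · rw [un 0 hj0.symm, hv.h_zero]
        · intro x hx
          by_cases e : x = j
          · rw [e, Function.update_self]; exact hpm
          · rw [un x e]; exact hv.h_mem x hx
        · intro x hx
          by_cases e : x = j
          · rw [e, Function.update_self]; exact hjp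
          · rw [un x e]; exact hv.le_h x hx
        · intro x hx y hy hxy
          by_cases e : x = j
          · by_cases e' : y = j
            · rw [e, e']
            · rw [e, Function.update_self, un y e']
              exact (hge y hy (e ▸ hxy)).le
          · by_cases e' : y = j
            · rw [e', Function.update_self, un x e]
              exact hle x hx (lt_of_le_of_ne (e' ▸ hxy) e)
            · rw [un x e, un y e']; exact hv.mono x hx y hy hxy
      · have hPe : ∀ W : Fin (n + 1) → Submodule F (Fin n → F),
            FP D (Function.update h j pm) ∅ Δ W ↔
              FP D h ∅ Δ W ∧ (W j).map Δ.mulVecLin ≤ W pm := by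
          intro W
          constructor
          · rintro ⟨w1, w2, w3, w4, w5⟩
            have hjj := w4 j hj
            rw [Function.update_self] at hjj
            refine ⟨⟨w1, w2, w3, fun x hx => ?_, by simp⟩, hjj⟩
            by_cases e : x = j
            · rw [e]
              exact hjj.trans (w3 _ hpm _ (hv.h_mem j hj) h2.le)
            · have := w4 x hx
              rwa [Function.update_of_ne e] at this
          · rintro ⟨⟨w1, w2, w3, w4, w5⟩, hjj⟩
            refine ⟨w1, w2, w3, fun x hx => ?_, by simp⟩
            by_cases e : x = j
            · rw [e, Function.update_self]; exact hjj
            · rw [Function.update_of_ne e]; exact w4 x hx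
        have hq : ∀ W : {W : Fin (n + 1) → Submodule F (Fin n → F) // FP D h ∅ Δ W},
            (qbp (mdim jm j pm Δ W.1) ((j : ℕ) - jm)).eval (Fintype.card F : ℤ) =
              if (W.1 j).map Δ.mulVecLin ≤ W.1 pm then 1 else 0 := by
          rintro ⟨W, w1, w2, w3, w4, w5⟩
          have hr := w2 j hj
          split_ifs with hc
          · have : W j ⊓ (W pm).comap Δ.mulVecLin = W j :=
              inf_eq_left.2 (Submodule.map_le_iff_le_comap.1 hc)
            unfold mdim
            simp only
            rw [this, hr, qbp_self, eval_one]
          · rw [qbp_of_lt, eval_zero]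
            have hlt2 : W j ⊓ (W pm).comap Δ.mulVecLin < W j := by
              refine lt_of_le_of_ne inf_le_left fun e => hc ?_
              exact Submodule.map_le_iff_le_comap.2 (inf_eq_left.1 e)
            have := Submodule.finrank_lt_finrank_of_lt hlt2
            rw [hr] at this
            unfold mdim
            simp only
            omega
        rw [Finset.sum_congr rfl fun W _ => hq W]
        unfold cnt
        rw [Nat.card_congr (Equiv.subtypeEquivRight hPe),
          ← Nat.card_congr (Equiv.subtypeSubtypeEquivSubtypeInter _ _),
          Nat.card_eq_fintype_card, Fintype.card_subtype, Finset.card_filter]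
        push_cast
        rfl
    · have hn := j.2
      set b : Fin (n + 1) := ⟨jm + a, by omega⟩ with hb
      have hbv : (b : ℕ) = jm + a := rfl
      have b1 : jm < b := by rw [Fin.lt_def]; omega
      have b2 : b < j := by rw [Fin.lt_def]; omega
      have hbD : b ∉ D := fun e => absurd (hpred b e b2) (not_le.2 b1)
      have hN : Nbr D jm b j := by
        refine ⟨hjm, hj, b1, b2, hbD, fun d hd => ?_⟩
        rcases lt_or_ge d j with e | e
        · exact Or.inl (hpred d hd e)
        · exact Or.inr e
      have hne : ∀ x ∈ D, x ≠ b := fun x hx e => hbD (e ▸ hx)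
      have un : ∀ x ∈ D, Function.update h b pm x = h x := fun x hx =>
          Function.update_of_ne (hne x hx) ..
      have us : Function.update h b pm b = pm := Function.update_self ..
      have hbpm : b < pm := b2.trans_le hjp
      refine ⟨insert b D, Function.update h b pm, ?_, ?_, fun F _ _ Δ _ => ?_⟩
      · refine ⟨Finset.mem_insert_of_mem hv.zero_mem, Finset.mem_insert_of_mem hv.last_mem,
          ?_, ?_, ?_, ?_⟩
        · rw [un 0 hv.zero_mem, hv.h_zero]
        · intro x hx
          rcases Finset.mem_insert.1 hx with rfl | hx
          · rw [us]; exact Finset.mem_insert_of_mem hpm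
          · rw [un x hx]; exact Finset.mem_insert_of_mem (hv.h_mem x hx)
        · intro x hx
          rcases Finset.mem_insert.1 hx with e | hx
          · rw [e, us]; exact hbpm.le
          · rw [un x hx]; exact hv.le_h x hx
        · intro x hx y hy hxy
          rcases Finset.mem_insert.1 hx with e | hx
          · rcases Finset.mem_insert.1 hy with e' | hy
            · rw [e, e']
            · rw [e, us, un y hy]
              rcases hN.split y hy with f | f
              · exact absurd ((e ▸ hxy).trans f) (not_le.2 b1)
              · exact (hge y hy f).le
          · rcases Finset.mem_insert.1 hy with e' | hy
            · rw [e', us, un x hx]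
              exact hle x hx ((e' ▸ hxy).trans_lt b2)
            · rw [un x hx, un y hy]; exact hv.mono x hx y hy hxy
      · rw [sum_ins D b hbD]
        have : (b : ℕ) < pm := hbpm
        omega
      · rw [cnt_insert D (Function.update h b pm) h jm b j hN (by rw [us]; exact hbpm.ne')
          (fun x hx => by
            unfold hcut
            rw [un x hx, if_neg (hne _ (hv.h_mem x hx))])]
        refine Finset.sum_congr rfl fun W _ => ?_
        obtain ⟨W, w1, w2, w3, w4, w5⟩ := W
        have hr := w2 jm hjm
        have hK : W jm ≤ W j ⊓ (W pm).comap Δ.mulVecLin :=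
          le_inf (w3 _ hjm _ hj hlt.le) (Submodule.map_le_iff_le_comap.1
            ((w4 jm hjm).trans (w3 _ (hv.h_mem _ hjm) _ hpm h1)))
        have := card_between _ _ hK (b : ℕ) (by rw [hr]; exact b1.le)
        rw [hr] at this
        have ea : a = (b : ℕ) - jm := by omega
        unfold mdim
        rw [ea, ← this]
        congr 1
        refine Nat.card_congr (Equiv.subtypeEquivRight fun U => ?_)
        simp only
        rw [us, le_inf_iff, Submodule.map_le_iff_le_comap]
        constructor
        · rintro ⟨x1, x2, x3, x4, -⟩
          exact ⟨x1, x2, x3, x4⟩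
        · rintro ⟨x1, x2, x3, x4⟩
          refine ⟨x1, x2, x3, x4, fun x hx e => ?_⟩
          rw [un x hx] at e
          exact absurd e (hne _ (hv.h_mem x hx))

end Elimination


section EliminationStep

set_option linter.unusedSectionVars false

variable {n : ℕ}

theorem elim_jump (D : Finset (Fin (n + 1)))
    (h : Fin (n + 1) → Fin (n + 1)) (pm p pp j : Fin (n + 1)) (hN : Nbr D pm p pp)
    (hv : Valid (insert p D) h)
    (hp : h p ≠ p) (hpp : h pp = h p) (hj : j ∈ D) (hjp : h j = p)
    (huniq : ∀ x ∈ D, h x = p → x = j)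
    (IH : ∀ D1 h1, Valid D1 h1 → ∑ d ∈ D1, (d : ℕ) < ∑ d ∈ insert p D, (d : ℕ) →
      Good n (cnt D1 h1 ∅)) : Good n (cnt (insert p D) h ∅) := by
  have i1 : ∀ x ∈ D, x ∈ insert p D := fun x hx => Finset.mem_insert_of_mem hx
  have hv' := valid_hcut D h pm p pp hN hv
  have hj0 : j ≠ 0 := by
    rintro rfl
    have := hN.pm_lt
    rw [← hjp, hv.h_zero] at this
    exact absurd this (by simp)
  obtain ⟨jm, hjm, hlt, hpred⟩ := exists_pred D hv'.zero_mem j hj0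
  have hjpm : j ≤ pm := by
    rcases hN.split j hj with e | e
    · exact e
    · have := hv.le_h j (i1 j hj)
      rw [hjp] at this
      exact absurd (e.trans this) (not_le.2 hN.lt_pp)
  have hjmne : h jm ≠ p := fun e => absurd (huniq jm hjm e) hlt.ne
  have hcj : hcut p pp h j = pp := by unfold hcut; rw [if_pos hjp]
  have hcjm : hcut p pp h jm = h jm := by unfold hcut; rw [if_neg hjmne]
  have hjm1 : hcut p pp h jm ≤ pm := by
    rcases hN.split _ (hv'.h_mem jm hjm) with e | e
    · exact e
    · rw [hcjm] at e ⊢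
      have := hv.mono jm (i1 _ hjm) j (i1 _ hj) hlt.le
      rw [hjp] at this
      exact absurd (e.trans this) (not_le.2 hN.lt_pp)
  have hT := elim_target D (hcut p pp h) jm j pm hv' hjm hj hN.pm_mem hlt hpred hjpm hjm1
    (by rw [hcj]; exact hN.pm_lt.trans hN.lt_pp)
  set x : ℕ := (j : ℕ) - jm with hx
  have hlt' : (jm : ℕ) < j := hlt
  have hpmp : (pm : ℕ) < p := hN.pm_lt
  have hppp : (p : ℕ) < pp := hN.lt_pp
  obtain ⟨c, hc⟩ := exists_unimod (fun m => if (pm : ℕ) + x - m ≤ p then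
    qbp ((pp : ℕ) - (pm + x - m)) ((p : ℕ) - (pm + x - m)) else 0) (x + 1)
  have hT' : ∀ a : ℕ, ∃ D1 h1, a ∈ Finset.range (x + 1) → (Valid D1 h1 ∧
      ∑ d ∈ D1, (d : ℕ) ≤ (∑ d ∈ D, (d : ℕ)) + pm ∧
      ∀ (F : Type) [Field F] [Fintype F] (Δ : Matrix (Fin n) (Fin n) F)
        [Fintype {W : Fin (n + 1) → Submodule F (Fin n → F) // FP D (hcut p pp h) ∅ Δ W}],
        cnt D1 h1 ∅ F Δ = ∑ W : {W : Fin (n + 1) → Submodule F (Fin n → F) //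
          FP D (hcut p pp h) ∅ Δ W},
          (qbp (mdim jm j pm Δ W.1) a).eval (Fintype.card F : ℤ)) := by
    intro a
    by_cases ha : a ∈ Finset.range (x + 1)
    · obtain ⟨D1, h1, hh⟩ := hT a (Nat.lt_succ_iff.1 (Finset.mem_range.1 ha))
      exact ⟨D1, h1, fun _ => hh⟩
    · exact ⟨D, h, fun e => absurd e ha⟩
  choose D1 h1 hD1 using hT'
  refine (Good.sum (Finset.range (x + 1)) (fun a F _ _ Δ =>
    (c a).eval (Fintype.card F : ℤ) * cnt (D1 a) (h1 a) ∅ F Δ) fun a ha =>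
      (IH (D1 a) (h1 a) (hD1 a ha).1 ?_).smul (c a)).congr fun F _ _ Δ => ?_
  · rw [sum_ins D p hN.nmem]
    have := (hD1 a ha).2.1
    omega
  · have := Fintype.ofFinite {W : Fin (n + 1) → Submodule F (Fin n → F) //
      FP D (hcut p pp h) ∅ Δ W}
    rw [cnt_insert D h (hcut p pp h) pm p pp hN hp (fun _ _ => rfl)]
    have e1 : ∀ a ∈ Finset.range (x + 1),
        (c a).eval (Fintype.card F : ℤ) * cnt (D1 a) (h1 a) ∅ F Δ =
        ∑ W : {W : Fin (n + 1) → Submodule F (Fin n → F) // FP D (hcut p pp h) ∅ Δ W},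
          (c a * qbp (mdim jm j pm Δ W.1) a).eval (Fintype.card F : ℤ) := by
      intro a ha
      rw [(hD1 a ha).2.2 F Δ, Finset.mul_sum]
      simp only [eval_mul]
    rw [Finset.sum_congr rfl e1, Finset.sum_comm]
    refine Finset.sum_congr rfl fun W _ => ?_
    obtain ⟨W, w1, w2, w3, w4, w5⟩ := W
    simp only
    have rj := w2 j hj
    have rjm := w2 jm hjm
    have rpm := w2 pm hN.pm_mem
    have rpp := w2 pp hN.pp_mem
    have hrr := rank_rel Δ.mulVecLin (W pm) (W j)
    rw [rj, rpm] at hrr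
    have hK : W jm ≤ W j ⊓ (W pm).comap Δ.mulVecLin :=
      le_inf (w3 _ hjm _ hj hlt.le) (Submodule.map_le_iff_le_comap.1
        ((w4 jm hjm).trans (w3 _ (hv'.h_mem _ hjm) _ hN.pm_mem hjm1)))
    have hK1 := Submodule.finrank_mono hK
    have hK2 : finrank F ↥(W j ⊓ (W pm).comap Δ.mulVecLin) ≤ finrank F (W j) :=
      Submodule.finrank_mono inf_le_left
    rw [rjm] at hK1
    rw [rj] at hK2
    have hm : mdim jm j pm Δ W + jm = finrank F ↥(W j ⊓ (W pm).comap Δ.mulVecLin) := by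
      unfold mdim; omega
    have hmx : mdim jm j pm Δ W < x + 1 := by omega
    have hsup : (pm : ℕ) + x - mdim jm j pm Δ W =
        finrank F ↥(W pm ⊔ (W j).map Δ.mulVecLin) := by omega
    rw [← eval_finsetSum, ← hc _ hmx, hsup]
    have hcond : ∀ U : Submodule F (Fin n → F),
        (finrank F U = (p : ℕ) ∧ W pm ≤ U ∧ U ≤ W pp ∧ U.map Δ.mulVecLin ≤ W (h p) ∧
        ∀ x ∈ D, h x = p → (W x).map Δ.mulVecLin ≤ U) ↔
        (finrank F U = (p : ℕ) ∧ W pm ⊔ (W j).map Δ.mulVecLin ≤ U ∧ U ≤ W pp) := by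
      intro U
      rw [sup_le_iff]
      constructor
      · rintro ⟨a1, a2, a3, -, a5⟩
        exact ⟨a1, ⟨a2, a5 j hj hjp⟩, a3⟩
      · rintro ⟨a1, ⟨a2, a5⟩, a3⟩
        refine ⟨a1, a2, a3, ?_, fun y hy e => by rw [huniq y hy e]; exact a5⟩
        have hd := w4 pp hN.pp_mem
        have e : hcut p pp h pp = h p := by
          unfold hcut; rw [if_neg (hpp ▸ hp), hpp]
        rw [e] at hd
        exact (Submodule.map_mono a3).trans hd
    rw [Nat.card_congr (Equiv.subtypeEquivRight hcond)]
    split_ifs with hle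
    · have hsl : W pm ⊔ (W j).map Δ.mulVecLin ≤ W pp := by
        have := w4 j hj
        rw [hcj] at this
        exact sup_le (w3 _ hN.pm_mem _ hN.pp_mem (hN.pm_lt.trans hN.lt_pp).le) this
      rw [card_between _ _ hsl _ hle, rpp]
    · rw [eval_zero]
      have : IsEmpty {U : Submodule F (Fin n → F) //
          finrank F U = (p : ℕ) ∧ W pm ⊔ (W j).map Δ.mulVecLin ≤ U ∧ U ≤ W pp} := by
        refine ⟨fun U => hle ?_⟩
        rw [← U.2.1]
        exact Submodule.finrank_mono U.2.2.1
      rw [Nat.card_of_isEmpty]; rfl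

theorem good_noEx (N : ℕ) : ∀ (D : Finset (Fin (n + 1))) (h : Fin (n + 1) → Fin (n + 1)),
    Valid D h → ∑ d ∈ D, (d : ℕ) < N → Good n (cnt D h ∅) := by
  induction N with
  | zero => intro D h _ hlt; exact absurd hlt (by omega)
  | succ N IH =>
    intro D h hv hlt
    by_cases hall : ∀ x ∈ D, h x = x
    · exact good_base D h hv hall
    push Not at hall
    obtain ⟨x0, hx0, hne0⟩ := hall
    let S := D.filter (fun p => p < h p ∧ ∃ s ∈ D, p < s ∧ h s = h p)
    have hS : S.Nonempty := by
      let T := D.filter (fun p => h p ≠ p)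
      have hT : T.Nonempty := ⟨x0, Finset.mem_filter.2 ⟨hx0, hne0⟩⟩
      have hmem := Finset.mem_filter.1 (T.max'_mem hT)
      set t := T.max' hT with ht
      have htlt : t < h t := lt_of_le_of_ne (hv.le_h t hmem.1) (Ne.symm hmem.2)
      refine ⟨t, Finset.mem_filter.2 ⟨hmem.1, htlt, h t, hv.h_mem t hmem.1, htlt, ?_⟩⟩
      by_contra hcon
      exact absurd (T.le_max' (h t) (Finset.mem_filter.2 ⟨hv.h_mem t hmem.1, hcon⟩))
        (not_le.2 htlt)
    have hpS := Finset.mem_filter.1 (S.min'_mem hS)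
    have hmin : ∀ y ∈ S, S.min' hS ≤ y := fun y hy => S.min'_le y hy
    set p := S.min' hS with hpdef
    obtain ⟨hpD, hplt, s, hsD, hps, hs⟩ := hpS
    have hp0 : p ≠ 0 := fun e => by
      rw [e, hv.h_zero] at hplt; exact absurd hplt (lt_irrefl _)
    obtain ⟨pm, hpm, pmlt, hpred⟩ := exists_pred D hv.zero_mem p hp0
    obtain ⟨pp, hpp, pplt, hnext⟩ := exists_next D p s hsD hps
    have hhpp : h pp = h p := le_antisymm
      (hs ▸ hv.mono pp hpp s hsD (hnext s hsD hps)) (hv.mono p hpD pp hpp pplt.le)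
    have hins : insert p (D.erase p) = D := Finset.insert_erase hpD
    have hN : Nbr (D.erase p) pm p pp := by
      refine ⟨Finset.mem_erase.2 ⟨pmlt.ne, hpm⟩, Finset.mem_erase.2 ⟨pplt.ne', hpp⟩, pmlt, pplt,
        Finset.notMem_erase _ _, fun d hd => ?_⟩
      obtain ⟨hd1, hd2⟩ := Finset.mem_erase.1 hd
      rcases lt_or_gt_of_ne hd1 with e | e
      · exact Or.inl (hpred d hd2 e)
      · exact Or.inr (hnext d hd2 e)
    have hv1 : Valid (insert p (D.erase p)) h := by rw [hins]; exact hv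
    have hgoal : Good n (cnt (insert p (D.erase p)) h ∅) := by
      by_cases hno : ∀ j ∈ D.erase p, h j ≠ p
      · refine elim_nojump _ h pm p pp hN hplt.ne' hhpp hno (IH _ _ (valid_hcut _ h pm p pp hN hv1) ?_)
        rw [← hins, sum_ins _ _ (Finset.notMem_erase _ _)] at hlt
        have : 0 < (p : ℕ) := Nat.pos_of_ne_zero fun e => hp0 (Fin.ext e)
        omega
      · push Not at hno
        obtain ⟨j, hj, hjp⟩ := hno
        have hlow : ∀ y ∈ D.erase p, h y = p → ∀ z ∈ D.erase p, h z = p → ¬ y < z := by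
          intro y hy hyp z hz hzp hyz
          obtain ⟨hy1, hy2⟩ := Finset.mem_erase.1 hy
          obtain ⟨hz1, hz2⟩ := Finset.mem_erase.1 hz
          have hyl : y < p := lt_of_le_of_ne (hyp ▸ hv.le_h y hy2) hy1
          exact absurd (hmin y (Finset.mem_filter.2 ⟨hy2, by rw [hyp]; exact hyl, z, hz2, hyz,
            by rw [hyp, hzp]⟩)) (not_le.2 hyl)
        refine elim_jump _ h pm p pp j hN hv1 hplt.ne' hhpp hj hjp (fun y hy hyp => ?_)
          (fun D1 h1 hv2 hs2 => IH D1 h1 hv2 ?_)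
        · exact le_antisymm (not_lt.1 (hlow j hj hjp y hy hyp)) (not_lt.1 (hlow y hy hyp j hj hjp))
        · rw [hins] at hs2; omega
    rwa [hins] at hgoal

end EliminationStep


section Exactness

set_option linter.unusedSectionVars false

variable {n : ℕ}

theorem card_part {X : Type} [Finite X] (C : X → Prop) (ρ : X → ℕ) (s : Finset ℕ)
    (hs : ∀ x, C x → ρ x ∈ s) :
    Nat.card {x // C x} = ∑ e ∈ s, Nat.card {x // C x ∧ ρ x = e} := by
  have := Fintype.ofFinite X
  rw [Nat.card_eq_fintype_card, Fintype.card_subtype,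
    Finset.card_eq_sum_card_fiberwise (f := ρ) (t := s)
      (fun x hx => hs x (Finset.mem_filter.1 hx).2)]
  refine Finset.sum_congr rfl fun e _ => ?_
  rw [Nat.card_eq_fintype_card, Fintype.card_subtype, Finset.filter_filter]

/-- Redirect arrows from below `i` into `p` towards `e`. -/
noncomputable def hred (i p e : Fin (n + 1)) (h : Fin (n + 1) → Fin (n + 1)) :
    Fin (n + 1) → Fin (n + 1) := fun x => if h x = p ∧ x ≤ i then e else h x

theorem valid_hred_self (D : Finset (Fin (n + 1))) (h : Fin (n + 1) → Fin (n + 1))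
    (i p : Fin (n + 1)) (hv : Valid D h) (hi : i ∈ D) (hp : h i = p) (hip : i < p)
    (gap : ∀ d ∈ D, d ≤ i ∨ p ≤ d) : Valid D (hred i p i h) := by
  have hp0 : p ≠ 0 := fun e => by rw [e] at hip; exact absurd hip (by simp)
  refine ⟨hv.zero_mem, hv.last_mem, ?_, ?_, ?_, ?_⟩
  · unfold hred; rw [if_neg]
    · exact hv.h_zero
    · rw [hv.h_zero]; exact fun e => hp0 e.1.symm
  · intro x hx
    unfold hred; split_ifs
    · exact hi
    · exact hv.h_mem x hx
  · intro x hx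
    unfold hred; split_ifs with e
    · exact e.2
    · exact hv.le_h x hx
  · intro x hx y hy hxy
    have hm := hv.mono x hx y hy hxy
    unfold hred; split_ifs with e1 e2 e2
    · exact le_rfl
    · rcases le_or_gt y i with f | f
      · have := hv.mono y hy i hi f
        rw [e1.1] at hm
        rw [hp] at this
        exact absurd ⟨le_antisymm this hm, f⟩ e2
      · exact f.le.trans (hv.le_h y hy)
    · rw [e2.1] at hm
      have hne : h x ≠ p := fun e => e1 ⟨e, hxy.trans e2.2⟩
      rcases gap _ (hv.h_mem x hx) with f | f
      · exact f
      · exact absurd (le_antisymm hm f) hne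
    · exact hm

theorem valid_hred_mid (D : Finset (Fin (n + 1))) (h : Fin (n + 1) → Fin (n + 1))
    (i p e : Fin (n + 1)) (hv : Valid D h) (hi : i ∈ D) (hp : h i = p) (hie : i < e) (hep : e < p)
    (gap : ∀ d ∈ D, d ≤ i ∨ p ≤ d) :
    Valid (insert e D) (Function.update (hred i p e h) e (h p)) := by
  have hip := hie.trans hep
  have hp0 : p ≠ 0 := fun e => by rw [e] at hip; exact absurd hip (by simp)
  have hpD : p ∈ D := hp ▸ hv.h_mem i hi
  have heD : e ∉ D := fun hc => by
    rcases gap e hc with f | f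
    · exact absurd f (not_le.2 hie)
    · exact absurd f (not_le.2 hep)
  have us : Function.update (hred i p e h) e (h p) e = h p := Function.update_self ..
  have un : ∀ x ∈ D, Function.update (hred i p e h) e (h p) x = hred i p e h x := fun x hx =>
    Function.update_of_ne (fun hc : x = e => heD (hc ▸ hx)) ..
  have hpp : p ≤ h p := hv.le_h p hpD
  refine ⟨Finset.mem_insert_of_mem hv.zero_mem, Finset.mem_insert_of_mem hv.last_mem, ?_, ?_, ?_, ?_⟩
  · rw [un 0 hv.zero_mem]
    unfold hred; rw [if_neg]
    · exact hv.h_zero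
    · rw [hv.h_zero]; exact fun e => hp0 e.1.symm
  · intro x hx
    rcases Finset.mem_insert.1 hx with e1 | hx
    · rw [e1, us]; exact Finset.mem_insert_of_mem (hv.h_mem p hpD)
    · rw [un x hx]
      unfold hred; split_ifs
      · exact Finset.mem_insert_self _ _
      · exact Finset.mem_insert_of_mem (hv.h_mem x hx)
  · intro x hx
    rcases Finset.mem_insert.1 hx with e1 | hx
    · rw [e1, us]; exact hep.le.trans hpp
    · rw [un x hx]
      unfold hred; split_ifs with e2
      · exact e2.2.trans hie.le
      · exact hv.le_h x hx
  · intro x hx y hy hxy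
    rcases Finset.mem_insert.1 hx with ex | hx
    · rcases Finset.mem_insert.1 hy with ey | hy
      · rw [ex, ey]
      · rw [ex, us, un y hy]
        rw [ex] at hxy
        have hpy : p ≤ y := (gap y hy).resolve_left fun f => absurd (hxy.trans f) (not_le.2 hie)
        unfold hred
        rw [if_neg fun f => absurd (hpy.trans f.2) (not_le.2 hip)]
        exact hv.mono p hpD y hy hpy
    · rcases Finset.mem_insert.1 hy with ey | hy
      · rw [ey, us, un x hx]
        rw [ey] at hxy
        have hxi : x ≤ i := (gap x hx).resolve_right fun f => absurd (f.trans hxy) (not_le.2 hep)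
        unfold hred
        split_ifs with e2
        · exact hep.le.trans hpp
        · exact (hv.mono x hx i hi hxi).trans (hp ▸ hpp)
      · rw [un x hx, un y hy]
        have hm := hv.mono x hx y hy hxy
        unfold hred; split_ifs with e1 e2 e2
        · exact le_rfl
        · rcases le_or_gt y i with f | f
          · have := hv.mono y hy i hi f
            rw [e1.1] at hm
            rw [hp] at this
            exact absurd ⟨le_antisymm this hm, f⟩ e2
          · exact hep.le.trans (((gap y hy).resolve_left (not_le.2 f)).trans (hv.le_h y hy))
        · rw [e2.1] at hm
          have hne : h x ≠ p := fun e => e1 ⟨e, hxy.trans e2.2⟩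
          rcases gap _ (hv.h_mem x hx) with f | f
          · exact f.trans hie.le
          · exact absurd (le_antisymm hm f) hne
        · exact hm

theorem FP_red_self {F : Type} [Field F] (D Ex : Finset (Fin (n + 1)))
    (h : Fin (n + 1) → Fin (n + 1)) (i p : Fin (n + 1)) (hv : Valid D h) (hi : i ∈ D)
    (hp : h i = p) (hip : i < p) (hEx : ∀ y ∈ Ex, ¬ (h y = p ∧ y ≤ i))
    (Δ : Matrix (Fin n) (Fin n) F) (V : Fin (n + 1) → Submodule F (Fin n → F)) :
    (FP D h Ex Δ V ∧ finrank F ↥(V i ⊔ (V i).map Δ.mulVecLin) = (i : ℕ)) ↔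
      FP D (hred i p i h) Ex Δ V := by
  have hpD : p ∈ D := hp ▸ hv.h_mem i hi
  constructor
  · rintro ⟨⟨v1, v2, v3, v4, v5⟩, hr⟩
    have hEq : V i = V i ⊔ (V i).map Δ.mulVecLin :=
      Submodule.eq_of_le_of_finrank_eq le_sup_left (by rw [hr, v2 i hi])
    have hle : (V i).map Δ.mulVecLin ≤ V i := by
      conv_rhs => rw [hEq]
      exact le_sup_right
    refine ⟨v1, v2, v3, fun x hx => ?_, fun y hy => ?_⟩
    · unfold hred; split_ifs with e
      · exact (Submodule.map_mono (v3 x hx i hi e.2)).trans hle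
      · exact v4 x hx
    · unfold hred; rw [if_neg (hEx y hy)]; exact v5 y hy
  · rintro ⟨v1, v2, v3, v4, v5⟩
    have hii := v4 i hi
    unfold hred at hii
    rw [if_pos ⟨hp, le_rfl⟩] at hii
    refine ⟨⟨v1, v2, v3, fun x hx => ?_, fun y hy => ?_⟩, ?_⟩
    · have := v4 x hx
      unfold hred at this; split_ifs at this with e
      · rw [e.1]; exact this.trans (v3 i hi p hpD hip.le)
      · exact this
    · have := v5 y hy
      unfold hred at this; rwa [if_neg (hEx y hy)] at this
    · rw [sup_eq_left.2 hii, v2 i hi]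

theorem FP_red_mid {F : Type} [Field F] [Fintype F] (D Ex : Finset (Fin (n + 1)))
    (h : Fin (n + 1) → Fin (n + 1)) (i p e : Fin (n + 1)) (hv : Valid D h) (hi : i ∈ D)
    (hp : h i = p) (hie : i < e) (hep : e < p) (hED : Ex ⊆ D) (hiE : i ∈ Ex)
    (gap : ∀ d ∈ D, d ≤ i ∨ p ≤ d)
    (hEx : ∀ y ∈ Ex.erase i, ¬ (h y = p ∧ y ≤ i))
    (Δ : Matrix (Fin n) (Fin n) F) (W : Fin (n + 1) → Submodule F (Fin n → F)) (hW : W e = ⊥)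
    (U : Submodule F (Fin n → F)) :
    FP (insert e D) (Function.update (hred i p e h) e (h p)) Ex Δ (Function.update W e U) ↔
    (FP D h (Ex.erase i) Δ W ∧ finrank F ↥(W i ⊔ (W i).map Δ.mulVecLin) = (e : ℕ)) ∧
      U = W i ⊔ (W i).map Δ.mulVecLin := by
  have hpD : p ∈ D := hp ▸ hv.h_mem i hi
  have heD : e ∉ D := fun hc => by
    rcases gap e hc with f | f
    · exact absurd f (not_le.2 hie)
    · exact absurd f (not_le.2 hep)
  have hne : ∀ x ∈ D, x ≠ e := fun x hx hc => heD (hc ▸ hx)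
  have us : Function.update (hred i p e h) e (h p) e = h p := Function.update_self ..
  have un : ∀ x ∈ D, Function.update (hred i p e h) e (h p) x = hred i p e h x := fun x hx =>
    Function.update_of_ne (hne x hx) ..
  have ws : Function.update W e U e = U := Function.update_self ..
  have wn : ∀ x, x ≠ e → Function.update W e U x = W x := fun x hx =>
    Function.update_of_ne hx ..
  have wD : ∀ x ∈ D, Function.update W e U x = W x := fun x hx => wn x (hne x hx)
  have i1 : ∀ x ∈ D, x ∈ insert e D := fun x hx => Finset.mem_insert_of_mem hx
  have i2 : e ∈ insert e D := Finset.mem_insert_self _ _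
  have ri : hred i p e h i = e := by unfold hred; rw [if_pos ⟨hp, le_rfl⟩]
  constructor
  · rintro ⟨v1, v2, v3, v4, v5⟩
    have a1 : W i ≤ U := by
      have := v3 i (i1 _ hi) e i2 hie.le
      rwa [ws, wD i hi] at this
    have a2 : (W i).map Δ.mulVecLin ≤ U := by
      have := v4 i (i1 _ hi)
      rwa [un i hi, ri, ws, wD i hi] at this
    have a3 : U ≤ W i ⊔ (W i).map Δ.mulVecLin := by
      have := v5 i hiE
      rwa [un i hi, ri, ws, wD i hi] at this
    have a4 : U ≤ W p := by
      have := v3 e i2 p (i1 _ hpD) hep.le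
      rwa [ws, wD p hpD] at this
    have hU : U = W i ⊔ (W i).map Δ.mulVecLin := le_antisymm a3 (sup_le a1 a2)
    refine ⟨⟨⟨?_, ?_, ?_, ?_, ?_⟩, ?_⟩, hU⟩
    · intro x hx
      by_cases hxp : x = e
      · rw [hxp, hW]
      · have := v1 x (by simp [hxp, hx])
        rwa [wn x hxp] at this
    · intro x hx
      have := v2 x (i1 _ hx)
      rwa [wD x hx] at this
    · intro x hx y hy hxy
      have := v3 x (i1 _ hx) y (i1 _ hy) hxy
      rwa [wD x hx, wD y hy] at this
    · intro x hx
      have := v4 x (i1 x hx)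
      rw [un x hx, wD x hx] at this
      unfold hred at this; split_ifs at this with f
      · rw [ws] at this
        rw [f.1]; exact this.trans a4
      · rwa [wD _ (hv.h_mem x hx)] at this
    · intro y hy
      have hyE := (Finset.mem_erase.1 hy).2
      have hyD := hED hyE
      have := v5 y hyE
      rw [un y hyD, wD y hyD] at this
      unfold hred at this
      rwa [if_neg (hEx y hy), wD _ (hv.h_mem y hyD)] at this
    · rw [← hU]
      have := v2 e i2
      rwa [ws] at this
  · rintro ⟨⟨⟨w1, w2, w3, w4, w5⟩, hr⟩, hU⟩
    have a4 : U ≤ W p := by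
      rw [hU]
      have := w4 i hi
      rw [hp] at this
      exact sup_le (w3 i hi p hpD (hie.trans hep).le) this
    have a1 : W i ≤ U := hU ▸ le_sup_left
    have a2 : (W i).map Δ.mulVecLin ≤ U := hU ▸ le_sup_right
    refine ⟨?_, ?_, ?_, ?_, ?_⟩
    · intro x hx
      rw [Finset.mem_insert, not_or] at hx
      rw [wn x hx.1, w1 x hx.2]
    · intro x hx
      rcases Finset.mem_insert.1 hx with ex | hx
      · rw [ex, ws, hU, hr]
      · rw [wD x hx, w2 x hx]
    · intro x hx y hy hxy
      rcases Finset.mem_insert.1 hx with ex | hx2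
      · rcases Finset.mem_insert.1 hy with ey | hy
        · rw [ex, ey]
        · rw [ex, ws, wD y hy]
          rw [ex] at hxy
          have hpy : p ≤ y := (gap y hy).resolve_left fun f => absurd (hxy.trans f) (not_le.2 hie)
          exact a4.trans (w3 _ hpD _ hy hpy)
      · rcases Finset.mem_insert.1 hy with ey | hy
        · rw [ey, ws, wD x hx2]
          rw [ey] at hxy
          have hxi : x ≤ i := (gap x hx2).resolve_right
            fun f => absurd (f.trans hxy) (not_le.2 hep)
          exact (w3 _ hx2 _ hi hxi).trans a1
        · rw [wD x hx2, wD y hy]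
          exact w3 x hx2 y hy hxy
    · intro x hx
      rcases Finset.mem_insert.1 hx with ex | hx2
      · rw [ex, us, ws, wD _ (hv.h_mem p hpD)]
        exact (Submodule.map_mono a4).trans (w4 p hpD)
      · rw [un x hx2, wD x hx2]
        unfold hred; split_ifs with f
        · rw [ws]
          exact (Submodule.map_mono (w3 x hx2 i hi f.2)).trans a2
        · rw [wD _ (hv.h_mem x hx2)]; exact w4 x hx2
    · intro y hyE
      have hyD := hED hyE
      rw [un y hyD, wD y hyD]
      by_cases hyi : y = i
      · rw [hyi, ri, ws, hU]
      · have hy : y ∈ Ex.erase i := Finset.mem_erase.2 ⟨hyi, hyE⟩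
        unfold hred
        rw [if_neg (hEx y hy), wD _ (hv.h_mem y hyD)]
        exact w5 y hy

theorem good_Ex (N : ℕ) : ∀ (D Ex : Finset (Fin (n + 1))) (h : Fin (n + 1) → Fin (n + 1)),
    Valid D h → Ex ⊆ D → (∀ i ∈ Ex, ∀ d ∈ D, d ≤ i ∨ h i ≤ d) →
    ∑ i ∈ Ex, ((h i : ℕ) - i + 1) < N → Good n (cnt D h Ex) := by
  induction N with
  | zero => intro D Ex h _ _ _ hlt; exact absurd hlt (by omega)
  | succ N IH =>
    intro D Ex h hv hED hgap hlt
    rcases Finset.eq_empty_or_nonempty Ex with rfl | ⟨i, hiE⟩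
    · exact good_noEx _ D h hv (Nat.lt_succ_self _)
    have hi := hED hiE
    have hErD : Ex.erase i ⊆ D := (Finset.erase_subset _ _).trans hED
    have hsum := Finset.add_sum_erase Ex (fun i => (h i : ℕ) - i + 1) hiE
    have hgapE : ∀ y ∈ Ex.erase i, ∀ d ∈ D, d ≤ y ∨ h y ≤ d := fun y hy =>
      hgap y (Finset.mem_of_mem_erase hy)
    have G0 : Good n (cnt D h (Ex.erase i)) := IH D (Ex.erase i) h hv hErD hgapE (by omega)
    rcases eq_or_lt_of_le (hv.le_h i hi) with heq | hip
    · refine G0.congr fun F _ _ Δ => ?_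
      unfold cnt
      congr 1
      refine Nat.card_congr (Equiv.subtypeEquivRight fun V => ?_)
      unfold FP
      refine and_congr Iff.rfl (and_congr Iff.rfl (and_congr Iff.rfl (and_congr Iff.rfl ?_)))
      constructor
      · exact fun H y hy => H y (Finset.mem_of_mem_erase hy)
      · intro H y hy
        by_cases hyi : y = i
        · rw [hyi, ← heq]; exact le_sup_left
        · exact H y (Finset.mem_erase.2 ⟨hyi, hy⟩)
    · obtain ⟨p, hp⟩ : ∃ p, h i = p := ⟨_, rfl⟩
      rw [hp] at hip
      have gap : ∀ d ∈ D, d ≤ i ∨ p ≤ d := hp ▸ hgap i hiE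
      have hipv : (i : ℕ) < p := hip
      rw [hp] at hsum
      have hpD : p ∈ D := hp ▸ hv.h_mem i hi
      have hEx : ∀ y ∈ Ex.erase i, ¬ (h y = p ∧ y ≤ i) := by
        rintro y hy ⟨e1, e2⟩
        have hne := (Finset.mem_erase.1 hy).1
        rcases hgapE y hy i hi with f | f
        · exact hne (le_antisymm e2 f)
        · rw [e1] at f; exact absurd f (not_le.2 hip)
      have hrE : ∀ e, ∀ y ∈ Ex.erase i, hred i p e h y = h y := fun e y hy => by
        unfold hred; rw [if_neg (hEx y hy)]
      have Gi : ∀ e ∈ Finset.Ico (i : ℕ) p, Good n (fun F _ _ Δ =>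
          (Nat.card {V : Fin (n + 1) → Submodule F (Fin n → F) // FP D h (Ex.erase i) Δ V ∧
            finrank F ↥(V i ⊔ (V i).map Δ.mulVecLin) = e} : ℤ)) := by
        intro e he
        obtain ⟨he1, he2⟩ := Finset.mem_Ico.1 he
        rcases eq_or_lt_of_le he1 with rfl | he1
        · have := IH D (Ex.erase i) (hred i p i h) (valid_hred_self D h i p hv hi hp hip gap) hErD
            (fun y hy => by rw [hrE i y hy]; exact hgapE y hy)
            (by
              rw [Finset.sum_congr rfl fun y hy => by rw [hrE i y hy]]
              omega)
          refine this.congr fun F _ _ Δ => ?_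
          unfold cnt
          congr 1
          exact Nat.card_congr (Equiv.subtypeEquivRight fun V =>
            FP_red_self D (Ex.erase i) h i p hv hi hp hip hEx Δ V)
        · have hpn := p.2
          obtain ⟨e', rfl⟩ : ∃ e' : Fin (n + 1), (e' : ℕ) = e := ⟨⟨e, by omega⟩, rfl⟩
          have hie : i < e' := he1
          have hep : e' < p := he2
          have heD : e' ∉ D := fun hc => by
            rcases gap e' hc with f | f
            · exact absurd f (not_le.2 hie)
            · exact absurd f (not_le.2 hep)
          have un : ∀ x ∈ D, Function.update (hred i p e' h) e' (h p) x = hred i p e' h x :=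
            fun x hx => Function.update_of_ne (fun hc : x = e' => heD (hc ▸ hx)) ..
          have ri : hred i p e' h i = e' := by unfold hred; rw [if_pos ⟨hp, le_rfl⟩]
          have := IH (insert e' D) Ex (Function.update (hred i p e' h) e' (h p))
            (valid_hred_mid D h i p e' hv hi hp hie hep gap)
            (hED.trans (Finset.subset_insert _ _))
            (by
              intro y hy d hd
              rw [un y (hED hy)]
              by_cases hyi : y = i
              · rw [hyi, ri]
                rcases Finset.mem_insert.1 hd with ed | hd
                · exact Or.inr ed.ge
                · rcases gap d hd with f | f
                  · exact Or.inl f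
                  · exact Or.inr (hep.le.trans f)
              · have hyE : y ∈ Ex.erase i := Finset.mem_erase.2 ⟨hyi, hy⟩
                rw [hrE e' y hyE]
                rcases Finset.mem_insert.1 hd with ed | hd
                · rw [ed]
                  rcases hgapE y hyE i hi with f | f
                  · rcases hgapE y hyE p hpD with f' | f'
                    · exact Or.inl (hep.le.trans f')
                    · rcases gap y (hED hy) with k | k
                      · exact absurd (le_antisymm k f) hyi
                      · exact Or.inl (hep.le.trans k)
                  · exact Or.inr (f.trans hie.le)
                · exact hgapE y hyE d hd)
            (by
              rw [← Finset.add_sum_erase Ex _ hiE, un i hi, ri,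
                Finset.sum_congr rfl fun y hy => by rw [un y (hErD hy), hrE e' y hy]]
              omega)
          refine this.congr fun F _ _ Δ => ?_
          have := Fintype.ofFinite {V : Fin (n + 1) → Submodule F (Fin n → F) //
            FP D h (Ex.erase i) Δ V ∧ finrank F ↥(V i ⊔ (V i).map Δ.mulVecLin) = (e' : ℕ)}
          unfold cnt
          rw [card_fib_int e' ⊥ (FP (insert e' D) (Function.update (hred i p e' h) e' (h p)) Ex Δ)
            (fun V => FP D h (Ex.erase i) Δ V ∧
              finrank F ↥(V i ⊔ (V i).map Δ.mulVecLin) = (e' : ℕ))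
            (fun W U => U = W i ⊔ (W i).map Δ.mulVecLin)
            (fun W hW => hW.1.1 e' heD)
            (fun W hW U => FP_red_mid D Ex h i p e' hv hi hp hie hep hED hiE gap hEx Δ W hW U)]
          simp [Nat.card_eq_fintype_card]
      refine (G0.sub (Good.sum (Finset.Ico (i : ℕ) p) _ Gi)).congr fun F _ _ Δ => ?_
      have hb : ∀ V : Fin (n + 1) → Submodule F (Fin n → F), FP D h (Ex.erase i) Δ V →
          V i ⊔ (V i).map Δ.mulVecLin ≤ V p := by
        rintro V ⟨v1, v2, v3, v4, v5⟩
        have := v4 i hi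
        rw [hp] at this
        exact sup_le (v3 i hi p hpD hip.le) this
      have hpart := card_part (fun V : Fin (n + 1) → Submodule F (Fin n → F) =>
        FP D h (Ex.erase i) Δ V) (fun V => finrank F ↥(V i ⊔ (V i).map Δ.mulVecLin))
        (Finset.Ico (i : ℕ) (p + 1)) (by
          intro V hV
          have h1 := Submodule.finrank_mono (hb V hV)
          have h2 : finrank F (V i) ≤ finrank F ↥(V i ⊔ (V i).map Δ.mulVecLin) :=
            Submodule.finrank_mono le_sup_left
          rw [hV.2.1 p hpD] at h1
          rw [hV.2.1 i hi] at h2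
          exact Finset.mem_Ico.2 ⟨h2, by omega⟩)
      rw [Finset.sum_Ico_succ_top hipv.le] at hpart
      have hlast : Nat.card {V : Fin (n + 1) → Submodule F (Fin n → F) // FP D h Ex Δ V} =
          Nat.card {V : Fin (n + 1) → Submodule F (Fin n → F) // FP D h (Ex.erase i) Δ V ∧
            finrank F ↥(V i ⊔ (V i).map Δ.mulVecLin) = p} := by
        refine Nat.card_congr (Equiv.subtypeEquivRight fun V => ?_)
        constructor
        · rintro ⟨v1, v2, v3, v4, v5⟩
          have hV : FP D h (Ex.erase i) Δ V :=
            ⟨v1, v2, v3, v4, fun y hy => v5 y (Finset.mem_of_mem_erase hy)⟩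
          refine ⟨hV, ?_⟩
          have := v5 i hiE
          rw [hp] at this
          rw [le_antisymm (hb V hV) this, v2 p hpD]
        · rintro ⟨hV, hr⟩
          have hE := Submodule.eq_of_le_of_finrank_eq (hb V hV) (by rw [hr, hV.2.1 p hpD])
          obtain ⟨v1, v2, v3, v4, v5⟩ := hV
          refine ⟨v1, v2, v3, v4, fun y hy => ?_⟩
          by_cases hyi : y = i
          · rw [hyi, hp, hE]
          · exact v5 y (Finset.mem_erase.2 ⟨hyi, hy⟩)
      unfold cnt
      rw [hlast, hpart]
      push_cast
      ring

end Exactness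


section FinalStep

set_option linter.unusedSectionVars false

variable {n : ℕ}

theorem iterSpan_zero {F : Type} [Field F] (Δ : Matrix (Fin n) (Fin n) F)
    (W : Submodule F (Fin n → F)) : iterSpan Δ W 0 = ⊥ := by
  simp [iterSpan]

theorem iterSpan_succ {F : Type} [Field F] (Δ : Matrix (Fin n) (Fin n) F)
    (W : Submodule F (Fin n → F)) (j : ℕ) :
    iterSpan Δ W (j + 1) = iterSpan Δ W j ⊔ W.map (Δ ^ j).mulVecLin := by
  unfold iterSpan
  rw [Finset.range_add_one, Finset.iSup_insert, sup_comm]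

theorem iterSpan_one {F : Type} [Field F] (Δ : Matrix (Fin n) (Fin n) F)
    (W : Submodule F (Fin n → F)) : iterSpan Δ W 1 = W := by
  rw [iterSpan_succ, iterSpan_zero, pow_zero, Matrix.mulVecLin_one, Submodule.map_id, bot_sup_eq]

theorem map_pow_succ {F : Type} [Field F] (Δ : Matrix (Fin n) (Fin n) F)
    (W : Submodule F (Fin n → F)) (j : ℕ) :
    W.map (Δ ^ (j + 1)).mulVecLin = (W.map (Δ ^ j).mulVecLin).map Δ.mulVecLin := by
  rw [pow_succ', Matrix.mulVecLin_mul, Submodule.map_comp]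

theorem iterSpan_step {F : Type} [Field F] (Δ : Matrix (Fin n) (Fin n) F)
    (W : Submodule F (Fin n → F)) (j : ℕ) :
    iterSpan Δ W (j + 2) = iterSpan Δ W (j + 1) ⊔ (iterSpan Δ W (j + 1)).map Δ.mulVecLin := by
  induction j with
  | zero =>
    rw [iterSpan_succ, iterSpan_one, map_pow_succ, pow_zero, Matrix.mulVecLin_one, Submodule.map_id]
  | succ j ih =>
    have hle : (iterSpan Δ W (j + 1)).map Δ.mulVecLin ≤ iterSpan Δ W (j + 2) := by
      rw [ih]; exact le_sup_right
    rw [iterSpan_succ Δ W (j + 2)]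
    conv_rhs => rw [iterSpan_succ Δ W (j + 1), Submodule.map_sup, ← map_pow_succ,
      ← iterSpan_succ Δ W (j + 1), ← sup_assoc]
    rw [sup_eq_left.2 hle]

theorem iterSpan_mono {F : Type} [Field F] (Δ : Matrix (Fin n) (Fin n) F)
    (W : Submodule F (Fin n → F)) : Monotone (iterSpan Δ W) :=
  monotone_nat_of_le_succ fun j => by rw [iterSpan_succ]; exact le_sup_left

theorem good_sigma (hn : 0 < n) (μ : ℕ →₀ ℕ) (hμ : IsPtn μ) :
    Good n (fun _ _ _ Δ => (sigmaProf μ Δ : ℤ)) := by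
  let S : ℕ → ℕ := fun j => ∑ i ∈ Finset.range j, μ i
  have hSs : ∀ j, S (j + 1) = S j + μ j := fun j => Finset.sum_range_succ _ _
  by_cases hbig : ∃ j, n < S (j + 1)
  · obtain ⟨j, hj⟩ := hbig
    refine (Good.zero n).congr fun F _ _ Δ => ?_
    have : IsEmpty {W : Submodule F (Fin n → F) // HasProfile Δ μ W} := by
      refine ⟨fun W => ?_⟩
      have h1 := W.2 j
      have h2 := Submodule.finrank_le (iterSpan Δ W.1 (j + 1))
      rw [h1, Module.finrank_fin_fun] at h2
      exact absurd hj (not_lt.2 h2)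
    unfold sigmaProf
    rw [Nat.card_of_isEmpty]; rfl
  push Not at hbig
  let s : ℕ → Fin (n + 1) := fun j => ⟨S (j + 1), Nat.lt_succ_of_le (hbig j)⟩
  have hsv : ∀ j, (s j : ℕ) = S (j + 1) := fun j => rfl
  have hsm : Monotone s := monotone_nat_of_le_succ fun j => by
    rw [Fin.le_def, hsv, hsv, hSs (j + 1)]; omega
  have hanti := ptn_antitone μ hμ
  have hwd0 : ∀ j k, j < k → s j = s k → s (j + 1) = s (k + 1) := by
    intro j k hjk e
    have h1 : s (j + 1) ≤ s k := hsm hjk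
    rw [← e, Fin.le_def, hsv, hsv, hSs (j + 1)] at h1
    have h2 : μ (k + 1) ≤ μ (j + 1) := hanti (by omega)
    have h3 := congrArg Fin.val e
    rw [hsv, hsv] at h3
    apply Fin.ext
    rw [hsv, hsv, hSs (j + 1), hSs (k + 1)]
    omega
  have hwd : ∀ j k, s j = s k → s (j + 1) = s (k + 1) := by
    intro j k e
    rcases lt_trichotomy j k with f | f | f
    · exact hwd0 j k f e
    · rw [f]
    · exact (hwd0 k j f e.symm).symm
  let h : Fin (n + 1) → Fin (n + 1) := fun x =>
    if hx : ∃ j, s j = x then s (hx.choose + 1) else x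
  have hs : ∀ j, h (s j) = s (j + 1) := by
    intro j
    have hx : ∃ k, s k = s j := ⟨j, rfl⟩
    simp only [h]
    rw [dif_pos hx]
    exact hwd _ _ hx.choose_spec
  have hns : ∀ x, (¬ ∃ j, s j = x) → h x = x := fun x hx => dif_neg hx
  have hslt : ∀ j, s j ≤ s (j + 1) := fun j => hsm (Nat.le_succ j)
  have hl : h (Fin.last n) = Fin.last n := by
    by_cases hx : ∃ j, s j = Fin.last n
    · obtain ⟨j, hj⟩ := hx
      rw [← hj, hs]
      exact le_antisymm (hj ▸ Fin.le_last _) (hslt j)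
    · exact hns _ hx
  have h0 : h 0 = 0 := by
    by_cases hx : ∃ j, s j = 0
    · obtain ⟨j, hj⟩ := hx
      rw [← hj, hs]
      have e1 := congrArg Fin.val hj
      rw [hsv] at e1
      have e2 : μ 0 ≤ S (j + 1) :=
        Finset.single_le_sum (f := fun i => μ i) (fun _ _ => Nat.zero_le _)
          (Finset.mem_range.2 (Nat.succ_pos j))
      have e3 : μ (j + 1) ≤ μ 0 := hanti (Nat.zero_le _)
      apply Fin.ext
      rw [hsv, hsv, hSs (j + 1)]
      have e4 : ((0 : Fin (n + 1)) : ℕ) = 0 := rfl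
      omega
    · exact hns _ hx
  let Ex : Finset (Fin (n + 1)) := Finset.univ.filter (fun x => ∃ j, s j = x)
  let D : Finset (Fin (n + 1)) := Finset.univ.filter
    (fun x => x = 0 ∨ x = Fin.last n ∨ ∃ j, s j = x)
  have mD : ∀ x, x ∈ D ↔ (x = 0 ∨ x = Fin.last n ∨ ∃ j, s j = x) := fun x => by simp [D]
  have mE : ∀ x, x ∈ Ex ↔ ∃ j, s j = x := fun x => by simp [Ex]
  have D0 : (0 : Fin (n + 1)) ∈ D := (mD _).2 (Or.inl rfl)
  have Dl : Fin.last n ∈ D := (mD _).2 (Or.inr (Or.inl rfl))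
  have Ds : ∀ j, s j ∈ D := fun j => (mD _).2 (Or.inr (Or.inr ⟨j, rfl⟩))
  have hsle : ∀ j k, s j ≤ s k → s j = s k ∨ j ≤ k := by
    intro j k e
    rcases le_or_gt j k with f | f
    · exact Or.inr f
    · exact Or.inl (le_antisymm e (hsm f.le))
  have hv : Valid D h := by
    refine ⟨D0, Dl, h0, ?_, ?_, ?_⟩
    · intro x hx
      rcases (mD x).1 hx with rfl | rfl | ⟨j, rfl⟩
      · rw [h0]; exact D0
      · rw [hl]; exact Dl
      · rw [hs]; exact Ds _
    · intro x hx
      rcases (mD x).1 hx with rfl | rfl | ⟨j, rfl⟩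
      · exact Fin.zero_le _
      · rw [hl]
      · rw [hs]; exact hslt j
    · intro x hx y hy hxy
      rcases (mD x).1 hx with rfl | rfl | ⟨j, rfl⟩
      · rw [h0]; exact Fin.zero_le _
      · rw [le_antisymm hxy (Fin.le_last y)]
      · rcases (mD y).1 hy with rfl | rfl | ⟨k, rfl⟩
        · rw [le_antisymm hxy (Fin.zero_le _)]
        · rw [hl]; exact Fin.le_last _
        · rcases hsle j k hxy with e | e
          · rw [e]
          · rw [hs, hs]; exact hsm (by omega)
  have hED : Ex ⊆ D := fun x hx => (mD x).2 (Or.inr (Or.inr ((mE x).1 hx)))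
  have hgap : ∀ i ∈ Ex, ∀ d ∈ D, d ≤ i ∨ h i ≤ d := by
    intro i hi d hd
    obtain ⟨j, rfl⟩ := (mE i).1 hi
    rcases (mD d).1 hd with rfl | rfl | ⟨k, rfl⟩
    · exact Or.inl (Fin.zero_le _)
    · exact Or.inr (Fin.le_last _)
    · rcases le_or_gt k j with f | f
      · exact Or.inl (hsm f)
      · rw [hs]; exact Or.inr (hsm f)
  refine (good_Ex _ D Ex h hv hED hgap (Nat.lt_succ_self _)).congr fun F _ _ Δ => ?_
  unfold cnt sigmaProf
  congr 1
  have key : ∀ V : Fin (n + 1) → Submodule F (Fin n → F), FP D h Ex Δ V →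
      ∀ j, V (s j) = iterSpan Δ (V (s 0)) (j + 1) := by
    rintro V ⟨v1, v2, v3, v4, v5⟩ j
    induction j with
    | zero => rw [iterSpan_one]
    | succ j ih =>
      rw [iterSpan_step, ← ih]
      have a := v4 (s j) (Ds j)
      have b := v5 (s j) ((mE _).2 ⟨j, rfl⟩)
      rw [hs] at a b
      exact le_antisymm b (sup_le (v3 _ (Ds j) _ (Ds _) (hslt j)) a)
  symm
  refine Nat.card_congr (Equiv.ofBijective (fun V : {V : Fin (n + 1) → Submodule F (Fin n → F) //
    FP D h Ex Δ V} => (⟨V.1 (s 0), fun j => ?_⟩ :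
      {W : Submodule F (Fin n → F) // HasProfile Δ μ W})) ⟨?_, ?_⟩)
  · rw [← key V.1 V.2 j, V.2.2.1 _ (Ds j)]
  · intro V V' e
    have e' : V.1 (s 0) = V'.1 (s 0) := congrArg Subtype.val e
    apply Subtype.ext
    funext x
    by_cases hx : x ∈ D
    · rcases (mD x).1 hx with rfl | rfl | ⟨j, rfl⟩
      · have a := V.2.2.1 0 hx
        have b := V'.2.2.1 0 hx
        rw [Fin.val_zero, Submodule.finrank_eq_zero] at a b
        rw [a, b]
      · have a := V.2.2.1 (Fin.last n) hx
        have b := V'.2.2.1 (Fin.last n) hx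
        rw [Submodule.eq_top_of_finrank_eq (S := V.1 (Fin.last n)) (by rw [a]; simp),
          Submodule.eq_top_of_finrank_eq (S := V'.1 (Fin.last n)) (by rw [b]; simp)]
      · rw [key V.1 V.2 j, key V'.1 V'.2 j, e']
    · rw [V.2.1 x hx, V'.2.1 x hx]
  · rintro ⟨W, hW⟩
    have hr : ∀ j, finrank F (iterSpan Δ W (j + 1)) = (s j : ℕ) := hW
    have weq : ∀ j k, s j = s k → iterSpan Δ W (j + 1) = iterSpan Δ W (k + 1) := by
      intro j k e
      rcases le_total j k with f | f
      · exact Submodule.eq_of_le_of_finrank_eq (iterSpan_mono Δ W (by omega)) (by rw [hr, hr, e])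
      · exact (Submodule.eq_of_le_of_finrank_eq (iterSpan_mono Δ W (by omega))
          (by rw [hr, hr, e])).symm
    let V : Fin (n + 1) → Submodule F (Fin n → F) := fun x =>
      if hx : ∃ j, s j = x then iterSpan Δ W (hx.choose + 1) else
        if x = Fin.last n then ⊤ else ⊥
    have Vs : ∀ j, V (s j) = iterSpan Δ W (j + 1) := by
      intro j
      have hx : ∃ k, s k = s j := ⟨j, rfl⟩
      simp only [V]
      rw [dif_pos hx]
      exact weq _ _ hx.choose_spec
    have Vl : V (Fin.last n) = ⊤ := by
      by_cases hx : ∃ j, s j = Fin.last n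
      · obtain ⟨j, hj⟩ := hx
        rw [← hj, Vs]
        apply Submodule.eq_top_of_finrank_eq
        rw [hr, hj]; simp
      · simp only [V]
        rw [dif_neg hx, if_pos trivial]
    have V0 : V 0 = ⊥ := by
      by_cases hx : ∃ j, s j = 0
      · obtain ⟨j, hj⟩ := hx
        rw [← hj, Vs, ← Submodule.finrank_eq_zero (R := F), hr, hj]; rfl
      · simp only [V]
        rw [dif_neg hx, if_neg]
        intro e
        have := congrArg Fin.val e
        simp at this
        omega
    have hFP : FP D h Ex Δ V := by
      refine ⟨?_, ?_, ?_, ?_, ?_⟩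
      · intro x hx
        rw [mD, not_or, not_or] at hx
        simp only [V]
        rw [dif_neg hx.2.2, if_neg hx.2.1]
      · intro x hx
        rcases (mD x).1 hx with rfl | rfl | ⟨j, rfl⟩
        · rw [V0]; simp
        · rw [Vl]; simp
        · rw [Vs, hr]
      · intro x hx y hy hxy
        rcases (mD x).1 hx with rfl | rfl | ⟨j, rfl⟩
        · rw [V0]; exact bot_le
        · rw [le_antisymm hxy (Fin.le_last y)]
        · rcases (mD y).1 hy with rfl | rfl | ⟨k, rfl⟩
          · rw [le_antisymm hxy (Fin.zero_le _)]
          · rw [Vl]; exact le_top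
          · rcases hsle j k hxy with e | e
            · rw [e]
            · rw [Vs, Vs]; exact iterSpan_mono Δ W (by omega)
      · intro x hx
        rcases (mD x).1 hx with rfl | rfl | ⟨j, rfl⟩
        · rw [V0, Submodule.map_bot]; exact bot_le
        · rw [hl, Vl]; exact le_top
        · rw [hs, Vs, Vs, iterSpan_step]; exact le_sup_right
      · intro i hi
        obtain ⟨j, rfl⟩ := (mE i).1 hi
        rw [hs, Vs, Vs, iterSpan_step]
    refine ⟨⟨V, hFP⟩, Subtype.ext ?_⟩
    show V (s 0) = W
    rw [Vs, iterSpan_one]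

end FinalStep

/-- For a fixed positive integer `n` and a fixed partition `μ`, there is a
family of polynomials `g l ∈ ℤ[t]`, indexed by the partitions `l` of `n`, such that for every
prime power `q`, every finite field `F` with `q` elements and every matrix `Δ ∈ Mₙ(F)`,
`σ(μ,Δ) = ∑_{l ⊢ n} g_l(q) · X_l(Δ)`. -/
theorem statement0 (n : ℕ) (hn : 0 < n) (μ : ℕ →₀ ℕ) (hμ : IsPtn μ) :
    ∃ g : (ℕ →₀ ℕ) → Polynomial ℤ,
      ∀ (q : ℕ), IsPrimePow q →
        ∀ (F : Type) [Field F] [Fintype F], Fintype.card F = q →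
          ∀ Δ : Matrix (Fin n) (Fin n) F,
            (sigmaProf μ Δ : ℤ) =
              ∑ᶠ l ∈ {l : ℕ →₀ ℕ | IsPtn l ∧ ptnSize l = n},
                (g l).eval (q : ℤ) * (Xflag Δ (fun i : Fin n => l i) : ℤ) := by
  obtain ⟨g, hg⟩ := good_sigma hn μ hμ
  refine ⟨g, fun q _ F _ _ hq Δ => ?_⟩
  subst hq
  exact hg F Δ
end

section
/- Let q be a prime power, n a positive integer, and let Δ ∈ M_n(𝔽_q) be regular nilpotent, i.e. nilpotent with one-dimensional null space (dim ker Δ = 1). Then for every partition μ with |μ| ≤ n, the number of subspaces of 𝔽_q^n with Δ-profile μ is σ(μ,Δ) = ∏_{i≥2} q^{μ_i²} [μ_{i−1} choose μ_i]_q (a finite product, since all but finitely many factors equal 1). -/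
open Matrix Module Polynomial

attribute [local instance] Classical.propDecidable

section aux
variable {F : Type} [Field F] {V : Type} [AddCommGroup V] [Module F V]

def SS (T : V →ₗ[F] V) (W : Submodule F V) : ℕ → Submodule F V
  | 0 => ⊥
  | j + 1 => W ⊔ (SS T W j).map T

lemma iterSpan_eq_SS {n : ℕ} (Δ : Matrix (Fin n) (Fin n) F)
    (W : Submodule F (Fin n → F)) (j : ℕ) : iterSpan Δ W j = SS Δ.mulVecLin W j := by
  induction j with
  | zero => simp [iterSpan, SS]
  | succ j ih =>
    rw [SS, ← ih]
    unfold iterSpan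
    have e : ∀ i, (W.map (Δ ^ i).mulVecLin).map Δ.mulVecLin = W.map (Δ ^ (i+1)).mulVecLin := by
      intro i
      rw [← Submodule.map_comp, ← Matrix.mulVecLin_mul, pow_succ']
    simp only [Submodule.map_iSup, e]
    apply le_antisymm
    · refine iSup₂_le fun i hi => ?_
      rcases i with _ | i
      · rw [pow_zero, Matrix.mulVecLin_one, Submodule.map_id]; exact le_sup_left
      · refine le_sup_of_le_right ?_
        exact le_iSup₂_of_le i (by simpa using hi) le_rfl
    · refine sup_le ?_ (iSup₂_le fun i hi => ?_)
      · refine le_iSup₂_of_le 0 (by simp) ?_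
        rw [pow_zero, Matrix.mulVecLin_one, Submodule.map_id]
      · exact le_iSup₂_of_le (i+1) (by simpa using hi) le_rfl

lemma SS_map (T : V →ₗ[F] V) (W : Submodule F V) (j : ℕ) :
    (SS T W j).map T = SS T (W.map T) j := by
  induction j with
  | zero => simp [SS]
  | succ j ih => rw [SS, SS, Submodule.map_sup, ← ih]

lemma SS_succ' (T : V →ₗ[F] V) (W : Submodule F V) (j : ℕ) :
    SS T W (j+1) = W ⊔ SS T (W.map T) j := by rw [SS, SS_map]

lemma SS_le_succ (T : V →ₗ[F] V) (W : Submodule F V) (j : ℕ) :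
    SS T W j ≤ SS T W (j+1) := by
  induction j with
  | zero => simp [SS]
  | succ j ih => exact sup_le_sup_left (Submodule.map_mono ih) _

lemma SS_mono (T : V →ₗ[F] V) (W : Submodule F V) : Monotone (SS T W) :=
  monotone_nat_of_le_succ (SS_le_succ T W)

lemma le_SS (T : V →ₗ[F] V) (W : Submodule F V) (j : ℕ) : W ≤ SS T W (j+1) := le_sup_left

lemma dim_map [FiniteDimensional F V] (T : V →ₗ[F] V) (A : Submodule F V) :
    finrank F (A.map T) + finrank F (A ⊓ LinearMap.ker T : Submodule F V) = finrank F A := by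
  have h := LinearMap.finrank_range_add_finrank_ker (T.domRestrict A)
  rw [LinearMap.range_domRestrict, LinearMap.ker_domRestrict] at h
  rw [← h]
  congr 1
  rw [← Submodule.map_comap_subtype]
  exact (LinearEquiv.finrank_eq
    (Submodule.equivMapOfInjective A.subtype (Submodule.subtype_injective _) _)).symm

lemma dim_concave [FiniteDimensional F V] (T : V →ₗ[F] V) (W : Submodule F V) (j : ℕ) :
    finrank F (SS T W (j+2)) + finrank F (SS T W j) ≤ 2 * finrank F (SS T W (j+1)) := by
  have h1 := dim_map T (SS T W (j+1))
  have h2 := dim_map T (SS T W j)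
  have h3 := Submodule.finrank_sup_add_finrank_inf_eq W ((SS T W (j+1)).map T)
  have h4 := Submodule.finrank_sup_add_finrank_inf_eq W ((SS T W j).map T)
  have h5 : finrank F (SS T W j ⊓ LinearMap.ker T : Submodule F V) ≤
      finrank F (SS T W (j+1) ⊓ LinearMap.ker T : Submodule F V) :=
    Submodule.finrank_mono (inf_le_inf_right _ (SS_le_succ T W j))
  have h6 : finrank F (W ⊓ (SS T W j).map T : Submodule F V) ≤
      finrank F (W ⊓ (SS T W (j+1)).map T : Submodule F V) :=
    Submodule.finrank_mono (inf_le_inf_left _ (Submodule.map_mono (SS_le_succ T W j)))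
  have e1 : SS T W (j+2) = W ⊔ (SS T W (j+1)).map T := rfl
  have e2 : SS T W (j+1) = W ⊔ (SS T W j).map T := rfl
  rw [← e1] at h3
  rw [← e2] at h4
  omega

lemma dim_map_ite [FiniteDimensional F V] (T : V →ₗ[F] V) (l : V) (hl : l ≠ 0)
    (hk : LinearMap.ker T = Submodule.span F {l}) (A : Submodule F V) :
    finrank F A = finrank F (A.map T) + if l ∈ A then 1 else 0 := by
  rw [← dim_map T A, hk]
  congr 1
  split_ifs with h
  · rw [inf_eq_right.2 (by simpa using h)]
    exact finrank_span_singleton hl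
  · rw [finrank_eq_zero_iff_of_free, Submodule.subsingleton_iff_eq_bot, eq_bot_iff]
    rintro x ⟨h1, h2⟩
    obtain ⟨c, rfl⟩ := Submodule.mem_span_singleton.1 h2
    by_cases hc : c = 0
    · simp [hc]
    · exact absurd ((Submodule.smul_mem_iff _ hc).1 h1) h

lemma dim_SS [FiniteDimensional F V] (T : V →ₗ[F] V) (l : V) (hl : l ≠ 0)
    (hk : LinearMap.ker T = Submodule.span F {l}) (W : Submodule F V) (j : ℕ) :
    finrank F (SS T W j) = finrank F (SS T (W.map T) j) + if l ∈ SS T W j then 1 else 0 := by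
  rw [← SS_map]; exact dim_map_ite T l hl hk _

lemma card_functionals [Fintype F] {Q : Type} [AddCommGroup Q] [Module F Q] [FiniteDimensional F Q]
    (l : Q) (A : Submodule F Q) (hA : l ∉ A) :
    Nat.card {φ : Dual F Q // φ l = 1 ∧ ∀ a ∈ A, φ a = 0} * Fintype.card F ^ (finrank F A + 1)
      = Fintype.card F ^ (finrank F Q) := by
  obtain ⟨f, hf1, hf2⟩ := Submodule.exists_le_ker_of_notMem hA
  have key : Nat.card {φ : Dual F Q // φ l = 1 ∧ ∀ a ∈ A, φ a = 0} =
      Nat.card (A ⊔ Submodule.span F {l}).dualAnnihilator := by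
    refine Nat.card_congr (Equiv.subtypeEquiv (Equiv.subRight ((f l)⁻¹ • f)) ?_)
    intro φ
    rw [Submodule.dualAnnihilator_sup_eq, Submodule.mem_inf, Submodule.mem_dualAnnihilator,
      Submodule.mem_dualAnnihilator]
    have : ∀ a ∈ A, f a = 0 := fun a ha => hf2 ha
    constructor
    · rintro ⟨h1, h2⟩
      refine ⟨fun a ha => by simp [h2 a ha, this a ha], fun a ha => ?_⟩
      obtain ⟨c, rfl⟩ := Submodule.mem_span_singleton.1 ha
      simp [h1, hf1]
    · rintro ⟨h1, h2⟩
      have := h2 l (Submodule.mem_span_singleton_self l)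
      refine ⟨by simpa [hf1, sub_eq_zero] using this, fun a ha => ?_⟩
      have h3 := h1 a ha
      simpa [‹∀ a ∈ A, f a = 0› a ha] using h3
  rw [key, Module.natCard_eq_pow_finrank (K := F), Nat.card_eq_fintype_card, ← pow_add]
  congr 1
  have h := Subspace.finrank_add_finrank_dualAnnihilator_eq (A ⊔ Submodule.span F {l})
  rw [← h]
  have h2 := Submodule.finrank_sup_add_finrank_inf_eq A (Submodule.span F {l})
  rw [finrank_span_singleton (by rintro rfl; simp at hA)] at h2
  have h3 : A ⊓ Submodule.span F {l} = ⊥ := by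
    rw [eq_bot_iff]
    rintro x ⟨h1, h2⟩
    obtain ⟨c, rfl⟩ := Submodule.mem_span_singleton.1 h2
    by_cases hc : c = 0
    · simp [hc]
    · exact absurd ((Submodule.smul_mem_iff _ hc).1 h1) hA
  rw [h3, finrank_bot] at h2
  omega

lemma lift_equiv (T : V →ₗ[F] V) (l : V)
    (hk : LinearMap.ker T = Submodule.span F {l}) (U A : Submodule F V)
    (hU : U ≤ LinearMap.range T) (l' : U.comap T) (hl' : (l' : V) = l) :
    Nat.card {W : Submodule F V // W.map T = U ∧ l ∉ W ⊔ A} =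
    Nat.card {φ : Dual F (U.comap T) // φ l' = 1 ∧ ∀ a ∈ A.submoduleOf (U.comap T), φ a = 0} := by
  have hTl : T l = 0 := by
    have : l ∈ LinearMap.ker T := by rw [hk]; exact Submodule.mem_span_singleton_self l
    exact this
  have hTl' : ∀ c : F, T ((c • l' : U.comap T) : V) = 0 := by intro c; simp [hl', hTl]
  symm
  refine Nat.card_congr (Equiv.ofBijective
    (fun φ => ⟨(LinearMap.ker φ.1).map (U.comap T).subtype, ?_, ?_⟩) ⟨?_, ?_⟩)
  · apply le_antisymm
    · rintro _ ⟨_, ⟨x, hx, rfl⟩, rfl⟩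
      exact x.2
    · intro u hu
      obtain ⟨v, rfl⟩ := hU hu
      refine ⟨v - (φ.1 ⟨v, hu⟩) • l, ⟨⟨v, hu⟩ - (φ.1 ⟨v, hu⟩) • l', ?_, ?_⟩, ?_⟩
      · simp [φ.2.1]
      · simp [hl']
      · simp [hTl]
  · intro h
    obtain ⟨w, ⟨x, hx, rfl⟩, a, ha, hwa⟩ := Submodule.mem_sup.1 h
    have ha' : a = ((l' - x : U.comap T) : V) := by
      rw [← hl'] at hwa
      simp [← hwa]
    have h0 := φ.2.2 (l' - x) (by rw [Submodule.submoduleOf, Submodule.mem_comap]; simpa [ha'] using ha)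
    have hx' : φ.1 x = 0 := hx
    rw [map_sub, φ.2.1, hx'] at h0
    simp at h0
  · rintro ⟨φ, hφ⟩ ⟨ψ, hψ⟩ h
    have h1 : LinearMap.ker φ = LinearMap.ker ψ :=
      Submodule.map_injective_of_injective (Submodule.subtype_injective _) (Subtype.ext_iff.1 h)
    refine Subtype.ext (LinearMap.ext fun x => ?_)
    have : x - φ x • l' ∈ LinearMap.ker φ := by simp [hφ.1]
    rw [h1] at this
    have h2 : ψ x - φ x = 0 := by simpa [hψ.1] using this
    exact (sub_eq_zero.1 h2).symm
  · rintro ⟨W, hW, hWA⟩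
    have hn : l' ∉ (W ⊔ A).submoduleOf (U.comap T) := by
      rw [Submodule.submoduleOf, Submodule.mem_comap]; simpa [hl'] using hWA
    obtain ⟨f, hf1, hf2⟩ := Submodule.exists_le_ker_of_notMem hn
    have hfz : ∀ x : U.comap T, (x : V) ∈ W ⊔ A → f x = 0 := fun x hx => hf2 hx
    refine ⟨⟨(f l')⁻¹ • f, by simp [hf1], fun a ha => ?_⟩, Subtype.ext ?_⟩
    · have : f a = 0 := hfz a ((le_sup_right : A ≤ W ⊔ A) ha)
      simp [this]
    · change (LinearMap.ker ((f l')⁻¹ • f)).map (U.comap T).subtype = W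
      rw [LinearMap.ker_smul _ _ (inv_ne_zero hf1)]
      apply le_antisymm
      · rintro _ ⟨x, hx, rfl⟩
        have hx0 : f x = 0 := hx
        have hxU : T x ∈ W.map T := by rw [hW]; exact x.2
        obtain ⟨w, hw, hwx⟩ := hxU
        have : (x : V) - w ∈ LinearMap.ker T := by simp [hwx]
        rw [hk] at this
        obtain ⟨c, hc⟩ := Submodule.mem_span_singleton.1 this
        have hfw : f (x - c • l') = 0 := by
          apply hfz
          have : ((x - c • l' : U.comap T) : V) = w := by simp [hl', hc]
          rw [this]; exact Submodule.mem_sup_left hw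
        rw [map_sub, hx0, map_smul, zero_sub, neg_eq_zero, smul_eq_mul, mul_eq_zero] at hfw
        have hc0 := hfw.resolve_right hf1
        rw [hc0, zero_smul] at hc
        have : (x : V) = w := (sub_eq_zero.1 hc.symm)
        simpa [this] using hw
      · intro w hw
        have hwU : w ∈ U.comap T := by
          rw [Submodule.mem_comap, ← hW]; exact Submodule.mem_map_of_mem hw
        exact ⟨⟨w, hwU⟩, hfz _ (Submodule.mem_sup_left hw), rfl⟩

/-- number of lifts -/
lemma lift_count [Fintype F] [FiniteDimensional F V] (T : V →ₗ[F] V) (l : V) (hl : l ≠ 0)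
    (hk : LinearMap.ker T = Submodule.span F {l}) (U : Submodule F V)
    (hU : U ≤ LinearMap.range T) (i : ℕ) (hi : l ∉ SS T U i) :
    Nat.card {W : Submodule F V // W.map T = U ∧ l ∉ SS T W (i+1)} *
      Fintype.card F ^ finrank F (SS T U i) = Fintype.card F ^ finrank F (SS T U (i+1)) := by
  have hTl : T l = 0 := by
    have : l ∈ LinearMap.ker T := by rw [hk]; exact Submodule.mem_span_singleton_self l
    exact this
  have e : Nat.card {W : Submodule F V // W.map T = U ∧ l ∉ SS T W (i+1)} =
      Nat.card {W : Submodule F V // W.map T = U ∧ l ∉ W ⊔ SS T U i} := by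
    refine Nat.card_congr (Equiv.subtypeEquivRight fun W => ?_)
    constructor <;> rintro ⟨rfl, h⟩ <;> refine ⟨rfl, ?_⟩
    · rwa [← SS_succ']
    · rwa [SS_succ']
  set A := SS T U i with hA
  have hlU : l ∈ U.comap T := by simp [hTl]
  rw [e, lift_equiv T l hk U A hU ⟨l, hlU⟩ rfl]
  have hc := card_functionals (F := F) (⟨l, hlU⟩ : U.comap T) (A.submoduleOf (U.comap T)) hi
  have d1 : finrank F (U.comap T) = finrank F U + 1 := by
    rw [dim_map_ite T l hl hk (U.comap T), Submodule.map_comap_eq, inf_eq_right.2 hU, if_pos hlU]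
  have d2 : finrank F (A.submoduleOf (U.comap T)) = finrank F (A ⊓ U.comap T : Submodule F V) := by
    rw [Submodule.submoduleOf, inf_comm, ← Submodule.map_comap_subtype]
    exact LinearEquiv.finrank_eq
      (Submodule.equivMapOfInjective (U.comap T).subtype (Submodule.subtype_injective _) _)
  have d3 : finrank F (A ⊓ U.comap T : Submodule F V) = finrank F (U ⊓ A.map T : Submodule F V) := by
    rw [dim_map_ite T l hl hk, if_neg (fun h => hi h.1), add_zero]
    suffices e : (A ⊓ U.comap T).map T = U ⊓ A.map T by rw [e]
    ext x
    constructor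
    · rintro ⟨y, ⟨h1, h2⟩, rfl⟩
      exact ⟨h2, y, h1, rfl⟩
    · rintro ⟨h1, y, h2, rfl⟩
      exact ⟨y, ⟨h2, h1⟩, rfl⟩
  have d4 : finrank F A = finrank F (A.map T) := by
    rw [dim_map_ite T l hl hk, if_neg hi, add_zero]
  have d5 := Submodule.finrank_sup_add_finrank_inf_eq U (A.map T)
  have d6 : SS T U (i+1) = U ⊔ A.map T := rfl
  rw [d6]
  rw [d2, d3, d1, pow_succ, pow_succ, ← mul_assoc] at hc
  have hq : 0 < Fintype.card F := Fintype.card_pos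
  have hc' := Nat.eq_of_mul_eq_mul_right hq hc
  apply Nat.eq_of_mul_eq_mul_right (pow_pos hq (finrank F (U ⊓ A.map T : Submodule F V)))
  rw [mul_right_comm, hc', ← pow_add, ← pow_add, d4, d5]
end aux
section alg

noncomputable def GG (q : ℕ) (a b : ℕ) : ℚ := (((qbp a b).eval (q : ℤ) : ℤ) : ℚ)

lemma GG_zero_right (q a : ℕ) : GG q a 0 = 1 := by cases a <;> simp [GG, qbp]
lemma GG_zero_succ (q b : ℕ) : GG q 0 (b+1) = 0 := by simp [GG, qbp]
lemma GG_succ_succ (q a b : ℕ) :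
    GG q (a+1) (b+1) = GG q a b + (q:ℚ)^(b+1) * GG q a (b+1) := by simp [GG, qbp]

lemma GG_I2 (q a : ℕ) (h : ∀ b, GG q a (b+1) * ((q:ℚ)^(b+1) - 1) * (q:ℚ)^b
      = GG q a b * ((q:ℚ)^a - (q:ℚ)^b)) (b : ℕ) :
    GG q (a+1) b * ((q:ℚ)^(a+1) - (q:ℚ)^b) = (q:ℚ)^b * ((q:ℚ)^(a+1) - 1) * GG q a b := by
  rcases b with _ | b
  · simp [GG_zero_right]
  · rw [GG_succ_succ]
    have := h b
    simp only [pow_succ] at *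
    linear_combination (-(q:ℚ)) * this

lemma GG_I1 (q a : ℕ) : ∀ b, GG q a (b+1) * ((q:ℚ)^(b+1) - 1) * (q:ℚ)^b
      = GG q a b * ((q:ℚ)^a - (q:ℚ)^b) := by
  induction a with
  | zero =>
    intro b
    rcases b with _ | b
    · simp [GG_zero_succ, GG_zero_right]
    · simp [GG_zero_succ]
  | succ a ih =>
    intro b
    rw [GG_I2 q a ih b, GG_succ_succ]
    have := ih b
    simp only [pow_succ] at *
    linear_combination ((q:ℚ) * (q:ℚ)^b) * this

noncomputable def ff (q N : ℕ) (μ : ℕ → ℕ) : ℚ :=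
  ∏ i ∈ Finset.range N, ((q:ℚ) ^ ((μ (i+1))^2) * GG q (μ i) (μ (i+1)))

lemma GG_I2r (q : ℕ) (hq : 0 < q) (b c : ℕ) :
    GG q (b+1) c * (((q:ℚ)⁻¹)^c - ((q:ℚ)⁻¹)^(b+1)) = (1 - ((q:ℚ)⁻¹)^(b+1)) * GG q b c := by
  have h := GG_I2 q b (GG_I1 q b) c
  have hq' : (q:ℚ) ≠ 0 := by positivity
  have h1 : (q:ℚ)^c ≠ 0 := by positivity
  have h2 : (q:ℚ)^(b+1) ≠ 0 := by positivity
  rw [inv_pow, inv_pow]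
  field_simp
  linear_combination h

lemma GG_I1r (q : ℕ) (hq : 0 < q) (a b c : ℕ) :
    (q:ℚ)^((b+1)^2) * GG q a (b+1) * ((q:ℚ)^(c^2) * GG q (b+1) c) *
      (((q:ℚ)⁻¹)^c - ((q:ℚ)⁻¹)^(b+1))
    = (q:ℚ)^(b^2) * GG q a b * ((q:ℚ)^(c^2) * GG q b c) * ((q:ℚ)^a - (q:ℚ)^b) := by
  have h := GG_I2r q hq b c
  have h' := GG_I1 q a b
  have h2 : (q:ℚ)^(b+1) ≠ 0 := by positivity
  have e : (1 - ((q:ℚ)⁻¹)^(b+1)) * (q:ℚ)^(b+1) = (q:ℚ)^(b+1) - 1 := by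
    rw [inv_pow]; field_simp
  have e2 : (q:ℚ)^((b+1)^2) = (q:ℚ)^(b^2) * (q:ℚ)^(b+1) * (q:ℚ)^b := by
    rw [← pow_add, ← pow_add]; congr 1; ring
  rw [e2]
  linear_combination ((q:ℚ)^(b^2) * (q:ℚ)^(b+1) * (q:ℚ)^b * GG q a (b+1) * (q:ℚ)^(c^2)) * h
    + ((q:ℚ)^(b^2) * (q:ℚ)^b * GG q a (b+1) * (q:ℚ)^(c^2) * GG q b c) * e
    + ((q:ℚ)^(b^2) * (q:ℚ)^(c^2) * GG q b c) * h'

lemma ff_zero (q : ℕ) (hq : 0 < q) (N : ℕ) (hN : 0 < N) (μ : ℕ → ℕ) (b : ℕ) (hb : μ 0 = b + 1) :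
    ff q N μ * (((q:ℚ)⁻¹)^(μ 1) - ((q:ℚ)⁻¹)^(μ 0))
      = ff q N (Function.update μ 0 b) * (1 - ((q:ℚ)⁻¹)^(μ 0)) := by
  obtain ⟨t, rfl⟩ : ∃ t, N = t + 1 := ⟨N - 1, by omega⟩
  unfold ff
  rw [Finset.prod_range_succ', Finset.prod_range_succ']
  simp only [Function.update_apply]
  simp [hb]
  linear_combination ((∏ i ∈ Finset.range t, ((q:ℚ) ^ ((μ (i+1+1))^2) * GG q (μ (i+1)) (μ (i+1+1)))) *
    (q:ℚ)^((μ 1)^2)) * GG_I2r q hq b (μ 1)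

lemma ff_succ (q : ℕ) (hq : 0 < q) (N k : ℕ) (hN : k + 1 < N) (μ : ℕ → ℕ) (b : ℕ)
    (hb : μ (k+1) = b + 1) :
    ff q N μ * (((q:ℚ)⁻¹)^(μ (k+2)) - ((q:ℚ)⁻¹)^(μ (k+1)))
      = ff q N (Function.update μ (k+1) b) * ((q:ℚ)^(μ k) - (q:ℚ)^b) := by
  obtain ⟨t, rfl⟩ : ∃ t, N = k + 2 + t := ⟨N - (k+2), by omega⟩
  unfold ff
  set g := fun i => ((q:ℚ) ^ ((μ (i+1))^2) * GG q (μ i) (μ (i+1))) with hg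
  set ν := Function.update μ (k+1) b with hν
  set g' := fun i => ((q:ℚ) ^ ((ν (i+1))^2) * GG q (ν i) (ν (i+1))) with hg'
  have sp : ∀ h : ℕ → ℚ, ∏ x ∈ Finset.range (k+2+t), h x =
      ((∏ x ∈ Finset.range k, h x) * h k * h (k+1)) * ∏ x ∈ Finset.range t, h (k+2+x) := by
    intro h
    rw [Finset.prod_range_add h (k+2) t, Finset.prod_range_succ h (k+1), Finset.prod_range_succ h k]
  rw [sp g, sp g']
  have e1 : ∏ x ∈ Finset.range k, g' x = ∏ x ∈ Finset.range k, g x := by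
    refine Finset.prod_congr rfl fun x hx => ?_
    have := Finset.mem_range.1 hx
    simp only [hg, hg', hν]
    rw [Function.update_of_ne (by omega), Function.update_of_ne (by omega)]
  have e2 : ∏ x ∈ Finset.range t, g' (k+2+x) = ∏ x ∈ Finset.range t, g (k+2+x) := by
    refine Finset.prod_congr rfl fun x hx => ?_
    simp only [hg, hg', hν]
    rw [Function.update_of_ne (by omega), Function.update_of_ne (by omega)]
  have n1 : ν (k+1) = b := by simp [hν]
  have n2 : ν k = μ k := by rw [hν, Function.update_of_ne (by omega)]
  have n3 : ν (k+2) = μ (k+2) := by rw [hν, Function.update_of_ne (by omega)]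
  rw [e1, e2]
  have := GG_I1r q hq (μ k) b (μ (k+2))
  simp only [hg, hg', n1, n2, n3, hb, show k+1+1 = k+2 from rfl]
  linear_combination ((∏ x ∈ Finset.range k, g x) * ∏ x ∈ Finset.range t, g (k+2+x)) * this

end alg
section count
variable {F : Type} [Field F] {V : Type} [AddCommGroup V] [Module F V] [FiniteDimensional F V]

def Pr (T : V →ₗ[F] V) (μ : ℕ → ℕ) (W : Submodule F V) : Prop :=
  ∀ j, finrank F (SS T W j) = ∑ i ∈ Finset.range j, μ i

noncomputable def tau (T : V →ₗ[F] V) (l : V) (μ : ℕ → ℕ) (j : ℕ) : ℕ :=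
  Nat.card {W : Submodule F V // Pr T μ W ∧ l ∉ SS T W j}

lemma sum_update' (μ : ℕ → ℕ) (j b : ℕ) (hb : μ j = b + 1) (k : ℕ) :
    ∑ i ∈ Finset.range k, μ i =
      ∑ i ∈ Finset.range k, Function.update μ j b i + if j < k then 1 else 0 := by
  induction k with
  | zero => simp
  | succ k ih =>
    rw [Finset.sum_range_succ, Finset.sum_range_succ, ih]
    by_cases h : k = j
    · subst h; simp [hb]; omega
    · rw [Function.update_of_ne h]
      split_ifs <;> omega

lemma Pr_stab {T : V →ₗ[F] V} {μ : ℕ → ℕ} {W : Submodule F V} (h : Pr T μ W) (j : ℕ)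
    (hj : μ j = 0) : (SS T W j).map T ≤ SS T W j ∧ SS T W (j+1) = SS T W j := by
  have e : SS T W j = SS T W (j+1) := by
    apply Submodule.eq_of_le_of_finrank_eq (SS_le_succ T W j)
    rw [h, h, Finset.sum_range_succ, hj, add_zero]
  refine ⟨?_, e.symm⟩
  conv_rhs => rw [e]
  exact le_sup_right

lemma le_range_of_inv (T : V →ₗ[F] V) (hT : IsNilpotent T) 
    (hk : finrank F (LinearMap.ker T) = 1) (X : Submodule F V) (hX : X.map T ≤ X)
    (hd : finrank F X < finrank F V) : X ≤ LinearMap.range T := by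
  by_contra hcon
  have h1 : LinearMap.range T < X ⊔ LinearMap.range T := by
    refine lt_of_le_of_ne le_sup_right fun h => hcon ?_
    rw [h]; exact le_sup_left
  have h2 := Submodule.finrank_lt_finrank_of_lt h1
  have h3 := LinearMap.finrank_range_add_finrank_ker T
  have h4 : X ⊔ LinearMap.range T = ⊤ := by
    apply Submodule.eq_top_of_finrank_eq
    have := Submodule.finrank_le (X ⊔ LinearMap.range T)
    omega
  have h5 : ∀ k : ℕ, X ⊔ LinearMap.range (T ^ k) = ⊤ := by
    intro k
    induction k with
    | zero => rw [pow_zero, Module.End.one_eq_id, LinearMap.range_id]; simp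
    | succ k ih =>
      rw [eq_top_iff, ← h4]
      refine sup_le le_sup_left ?_
      rw [LinearMap.range_eq_map, ← ih, Submodule.map_sup]
      refine sup_le_sup hX ?_
      rw [pow_succ', Module.End.mul_eq_comp, LinearMap.range_comp]
  obtain ⟨k, hk⟩ := hT
  have h6 := h5 k
  rw [hk, LinearMap.range_zero, sup_bot_eq] at h6
  rw [h6, finrank_top] at hd
  exact lt_irrefl _ hd

lemma mem_of_inv (T : V →ₗ[F] V) (hT : IsNilpotent T) (l : V)
    (hk : LinearMap.ker T = Submodule.span F {l}) (X : Submodule F V) (hX : X.map T ≤ X)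
    (h0 : X ≠ ⊥) : l ∈ X := by
  by_contra hcon
  have hinj : ∀ x ∈ X, T x = 0 → x = 0 := by
    intro x hx hx0
    have : x ∈ LinearMap.ker T := hx0
    rw [hk] at this
    obtain ⟨c, rfl⟩ := Submodule.mem_span_singleton.1 this
    by_cases hc : c = 0
    · simp [hc]
    · exact absurd ((Submodule.smul_mem_iff _ hc).1 hx) hcon
  have h : ∀ k : ℕ, ∀ x ∈ X, (T ^ k) x = 0 → x = 0 := by
    intro k
    induction k with
    | zero => intro x _ h; simpa using h
    | succ k ih =>
      intro x hx h
      rw [pow_succ, Module.End.mul_apply] at h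
      exact hinj x hx (ih _ (hX (Submodule.mem_map_of_mem hx)) h)
  obtain ⟨k, hk⟩ := hT
  apply h0
  rw [eq_bot_iff]
  intro x hx
  exact h k x hx (by simp [hk])

lemma card_split {α : Type} [Finite α] (p a b : α → Prop) (h : ∀ x, b x → a x) :
    Nat.card {x // p x ∧ a x} = Nat.card {x // p x ∧ b x} + Nat.card {x // p x ∧ a x ∧ ¬ b x} := by
  have := Fintype.ofFinite α
  rw [Nat.card_eq_fintype_card, Nat.card_eq_fintype_card, Nat.card_eq_fintype_card,
    Fintype.card_subtype, Fintype.card_subtype, Fintype.card_subtype,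
    ← Finset.card_filter_add_card_filter_not (s := Finset.univ.filter fun x => p x ∧ a x) b,
    Finset.filter_filter, Finset.filter_filter]
  congr 2
  · ext x; have := h x; simp; tauto
  · ext x; simp; tauto

lemma Pr_le_range (T : V →ₗ[F] V) (hT : IsNilpotent T) (hk : finrank F (LinearMap.ker T) = 1)
    (ν : ℕ → ℕ) (N : ℕ) (hN : ∀ i, N ≤ i → ν i = 0)
    (hs : ∑ i ∈ Finset.range N, ν i < finrank F V) (U : Submodule F V) (hU : Pr T ν U) :
    U ≤ LinearMap.range T := by
  have h := Pr_stab hU N (hN N le_rfl)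
  have h2 : U ≤ SS T U N := by rw [← h.2]; exact le_SS T U N
  exact h2.trans (le_range_of_inv T hT hk _ h.1 (by rw [hU]; exact hs))

lemma lift_total [Fintype F] (T : V →ₗ[F] V) (hT : IsNilpotent T) (l : V) (hl : l ≠ 0)
    (hk : LinearMap.ker T = Submodule.span F {l})
    (ν : ℕ → ℕ) (N : ℕ) (hN : ∀ i, N ≤ i → ν i = 0)
    (hs : ∑ i ∈ Finset.range N, ν i < finrank F V) (i : ℕ) :
    Nat.card {W : Submodule F V // Pr T ν (W.map T) ∧ l ∉ SS T W (i+1)} =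
      Fintype.card F ^ (ν i) * tau T l ν i := by
  have : Finite V := Module.finite_of_finite F
  have hk1 : finrank F (LinearMap.ker T) = 1 := by rw [hk]; exact finrank_span_singleton hl
  let e : {W : Submodule F V // Pr T ν (W.map T) ∧ l ∉ SS T W (i+1)} ≃
      Σ U : {U : Submodule F V // Pr T ν U ∧ l ∉ SS T U i},
        {W : Submodule F V // W.map T = U.1 ∧ l ∉ SS T W (i+1)} :=
    { toFun := fun W => ⟨⟨W.1.map T, W.2.1, fun h => W.2.2 (by
          rw [SS_succ']; exact Submodule.mem_sup_right h)⟩, ⟨W.1, rfl, W.2.2⟩⟩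
      invFun := fun x => ⟨x.2.1, by rw [x.2.2.1]; exact x.1.2.1, x.2.2.2⟩
      left_inv := fun W => rfl
      right_inv := by
        rintro ⟨⟨U, hU⟩, ⟨W, hWU, hW⟩⟩
        change W.map T = U at hWU
        subst hWU
        rfl }
  have := Fintype.ofFinite {U : Submodule F V // Pr T ν U ∧ l ∉ SS T U i}
  rw [Nat.card_congr e, Nat.card_sigma]
  have hc : ∀ U : {U : Submodule F V // Pr T ν U ∧ l ∉ SS T U i},
      Nat.card {W : Submodule F V // W.map T = U.1 ∧ l ∉ SS T W (i+1)} = Fintype.card F ^ (ν i) := by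
    rintro ⟨U, hU1, hU2⟩
    have h := lift_count T l hl hk U (Pr_le_range T hT hk1 ν N hN hs U hU1) i hU2
    rw [hU1, hU1, Finset.sum_range_succ, pow_add, mul_comm (_ ^ _) (_ ^ ν i)] at h
    exact Nat.eq_of_mul_eq_mul_right (pow_pos Fintype.card_pos _) h
  rw [Finset.sum_congr rfl (fun U _ => hc U), Finset.sum_const, smul_eq_mul, mul_comm, tau,
    Nat.card_eq_fintype_card, Finset.card_univ]

lemma mem_iff_lt (T : V →ₗ[F] V) (l : V) (W : Submodule F V) (j : ℕ) (h1 : l ∉ SS T W j)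
    (h2 : l ∈ SS T W (j+1)) (k : ℕ) : l ∈ SS T W k ↔ j < k := by
  constructor
  · intro h
    by_contra hc
    exact h1 (SS_mono T W (not_lt.1 hc) h)
  · intro h
    exact SS_mono T W h h2

lemma Pr_iff (T : V →ₗ[F] V) (l : V) (hl : l ≠ 0)
    (hk : LinearMap.ker T = Submodule.span F {l}) (μ : ℕ → ℕ) (j b : ℕ) (hb : μ j = b + 1)
    (W : Submodule F V) (h1 : l ∉ SS T W j) (h2 : l ∈ SS T W (j+1)) :
    Pr T μ W ↔ Pr T (Function.update μ j b) (W.map T) := by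
  unfold Pr
  refine forall_congr' fun k => ?_
  rw [dim_SS T l hl hk W k, sum_update' μ j b hb k]
  simp only [mem_iff_lt T l W j h1 h2 k]
  split_ifs <;> omega

/-- when `μ j = μ (j+1)` the position is impossible -/
lemma no_pos (T : V →ₗ[F] V) (l : V) (hl : l ≠ 0)
    (hk : LinearMap.ker T = Submodule.span F {l}) (μ : ℕ → ℕ) (j : ℕ) (hb : μ j = μ (j+1))
    (W : Submodule F V) (h1 : l ∉ SS T W j) (h2 : l ∈ SS T W (j+1)) : ¬ Pr T μ W := by
  intro h
  have a0 := dim_SS T l hl hk W j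
  have a1 := dim_SS T l hl hk W (j+1)
  have a2 := dim_SS T l hl hk W (j+2)
  have c := dim_concave T (W.map T) j
  rw [if_neg h1, h] at a0
  rw [if_pos h2, h, Finset.sum_range_succ] at a1
  rw [if_pos ((mem_iff_lt T l W j h1 h2 _).2 (by omega)), h, Finset.sum_range_succ,
    Finset.sum_range_succ] at a2
  omega

lemma tau_split [Fintype F] (T : V →ₗ[F] V) (l : V) (μ : ℕ → ℕ) (j : ℕ) :
    tau T l μ j = tau T l μ (j+1) +
      Nat.card {W : Submodule F V // Pr T μ W ∧ l ∉ SS T W j ∧ l ∈ SS T W (j+1)} := by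
  have : Finite V := Module.finite_of_finite F
  have := card_split (Pr T μ) (fun W => l ∉ SS T W j) (fun W => l ∉ SS T W (j+1))
    (fun W h h' => h (SS_le_succ T W j h'))
  simp only [not_not] at this
  exact this

lemma tau_rec_succ [Fintype F] (T : V →ₗ[F] V) (hT : IsNilpotent T) (l : V) (hl : l ≠ 0)
    (hk : LinearMap.ker T = Submodule.span F {l})
    (μ : ℕ → ℕ) (N : ℕ) (hN : ∀ i, N ≤ i → μ i = 0)
    (hs : ∑ i ∈ Finset.range N, μ i ≤ finrank F V) (k b : ℕ) (hb : μ (k+1) = b + 1) :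
    tau T l μ (k+1) + Fintype.card F ^ b * tau T l (Function.update μ (k+1) b) (k+1) =
     tau T l μ (k+2) + Fintype.card F ^ (μ k) * tau T l (Function.update μ (k+1) b) k := by
  have : Finite V := Module.finite_of_finite F
  set ν := Function.update μ (k+1) b with hν
  have hkN : k + 1 < N := by
    by_contra h
    have := hN (k+1) (by omega)
    omega
  have hνN : ∀ i, N ≤ i → ν i = 0 := by
    intro i hi
    rw [hν, Function.update_of_ne (by omega)]; exact hN i hi
  have hνs : ∑ i ∈ Finset.range N, ν i < finrank F V := by
    have := sum_update' μ (k+1) b hb N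
    rw [← hν, if_pos hkN] at this
    omega
  have h1 := lift_total T hT l hl hk ν N hνN hνs k
  have h2 := lift_total T hT l hl hk ν N hνN hνs (k+1)
  have n1 : ν (k+1) = b := by simp [hν]
  have n2 : ν k = μ k := by rw [hν, Function.update_of_ne (by omega)]
  rw [n2] at h1
  rw [n1] at h2
  rw [← h1, ← h2, tau_split T l μ (k+1)]
  have h3 := card_split (fun W : Submodule F V => Pr T ν (W.map T))
    (fun W => l ∉ SS T W (k+1)) (fun W => l ∉ SS T W (k+2))
    (fun W h h' => h (SS_le_succ T W _ h'))
  simp only [not_not] at h3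
  rw [h3]
  have h4 : Nat.card {W : Submodule F V // Pr T μ W ∧ l ∉ SS T W (k+1) ∧ l ∈ SS T W (k+1+1)} =
      Nat.card {W : Submodule F V // Pr T ν (W.map T) ∧ l ∉ SS T W (k+1) ∧ l ∈ SS T W (k+2)} := by
    refine Nat.card_congr (Equiv.subtypeEquivRight fun W => ?_)
    refine and_congr_left fun h => ?_
    exact Pr_iff T l hl hk μ (k+1) b hb W h.1 h.2
  rw [h4]
  ring

lemma tau_zero (T : V →ₗ[F] V) (l : V) (hl : l ≠ 0) (μ : ℕ → ℕ) :
    tau T l μ 0 = Nat.card {W : Submodule F V // Pr T μ W} := by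
  refine Nat.card_congr (Equiv.subtypeEquivRight fun W => ?_)
  simp [SS, hl]

lemma tau_rec_zero [Fintype F] (T : V →ₗ[F] V) (hT : IsNilpotent T) (l : V) (hl : l ≠ 0)
    (hk : LinearMap.ker T = Submodule.span F {l})
    (μ : ℕ → ℕ) (N : ℕ) (hN : ∀ i, N ≤ i → μ i = 0)
    (hs : ∑ i ∈ Finset.range N, μ i ≤ finrank F V) (b : ℕ) (hb : μ 0 = b + 1) :
    tau T l μ 0 = tau T l μ 1 + 
      Nat.card {W : Submodule F V // Pr T (Function.update μ 0 b) W} := by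
  have : Finite V := Module.finite_of_finite F
  set ν := Function.update μ 0 b with hν
  have hkN : 0 < N := by
    by_contra h
    have := hN 0 (by omega)
    omega
  have hνN : ∀ i, N ≤ i → ν i = 0 := by
    intro i hi
    rw [hν, Function.update_of_ne (by omega)]; exact hN i hi
  have hνs : ∑ i ∈ Finset.range N, ν i < finrank F V := by
    have := sum_update' μ 0 b hb N
    rw [← hν, if_pos hkN] at this
    omega
  have hk1 : finrank F (LinearMap.ker T) = 1 := by rw [hk]; exact finrank_span_singleton hl
  have s0 : ∀ W : Submodule F V, l ∉ SS T W 0 := fun W => by simpa [SS] using hl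
  have s1 : ∀ W : Submodule F V, SS T W (0+1) = W := fun W => by simp [SS]
  have hTl : T l = 0 := by
    have : l ∈ LinearMap.ker T := by rw [hk]; exact Submodule.mem_span_singleton_self l
    exact this
  have mc : ∀ U : Submodule F V, Pr T ν U → (U.comap T).map T = U := fun U hU => by
    rw [Submodule.map_comap_eq, inf_eq_right.2 (Pr_le_range T hT hk1 ν N hνN hνs U hU)]
  rw [tau_split T l μ 0]
  congr 1
  refine Nat.card_congr
    { toFun := fun W => ⟨W.1.map T, (Pr_iff T l hl hk μ 0 b hb W.1 W.2.2.1 W.2.2.2).1 W.2.1⟩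
      invFun := fun U => ⟨U.1.comap T, ?_, s0 _, ?_⟩
      left_inv := ?_
      right_inv := fun U => Subtype.ext (mc U.1 U.2) }
  · rw [Pr_iff T l hl hk μ 0 b hb _ (s0 _) (by rw [s1]; simp [hTl]), mc U.1 U.2]
    exact U.2
  · rw [s1]; simp [hTl]
  · rintro ⟨W, hW, h0, h1⟩
    rw [s1] at h1
    refine Subtype.ext ?_
    change (W.map T).comap T = W
    rw [Submodule.comap_map_eq, hk, sup_eq_left]
    simpa using h1

lemma tau_eq_of_eq [Fintype F] (T : V →ₗ[F] V) (l : V) (hl : l ≠ 0)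
    (hk : LinearMap.ker T = Submodule.span F {l})
    (μ : ℕ → ℕ) (j : ℕ) (hb : μ j = μ (j+1)) : tau T l μ j = tau T l μ (j+1) := by
  rw [tau_split]
  have : IsEmpty {W : Submodule F V // Pr T μ W ∧ l ∉ SS T W j ∧ l ∈ SS T W (j+1)} :=
    ⟨fun W => no_pos T l hl hk μ j hb W.1 W.2.2.1 W.2.2.2 W.2.1⟩
  simp

lemma tau_vanish (T : V →ₗ[F] V) (hT : IsNilpotent T) (l : V)
    (hk : LinearMap.ker T = Submodule.span F {l})
    (μ : ℕ → ℕ) (h0 : 0 < μ 0) (j : ℕ) (hb : μ j = 0) : tau T l μ j = 0 := by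
  have : IsEmpty {W : Submodule F V // Pr T μ W ∧ l ∉ SS T W j} := by
    refine ⟨fun W => W.2.2 ?_⟩
    refine mem_of_inv T hT l hk _ (Pr_stab W.2.1 j hb).1 fun hbot => ?_
    have h1 := W.2.1 1
    have h2 := W.2.1 j
    rw [hbot, finrank_bot] at h2
    have h3 : μ 0 = 0 := by
      rcases j with _ | j
      · exact hb
      · have := Finset.sum_eq_zero_iff.1 h2.symm 0 (by simp)
        exact this
    omega
  rw [tau]; simp

lemma card_Pr_zero (T : V →ₗ[F] V) (μ : ℕ → ℕ) (h : ∀ i, μ i = 0) :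
    Nat.card {W : Submodule F V // Pr T μ W} = 1 := by
  rw [Nat.card_eq_one_iff_unique]
  have hb : ∀ W : Submodule F V, Pr T μ W → W = ⊥ := by
    intro W hW
    have h1 := hW 1
    have h2 : SS T W 1 = W := by simp [SS]
    rw [h2, Finset.sum_range_one, h] at h1
    exact Submodule.finrank_eq_zero.1 h1
  refine ⟨⟨fun A B => Subtype.ext ((hb _ A.2).trans (hb _ B.2).symm)⟩, ⟨⊥, fun j => ?_⟩⟩
  have : SS T (⊥ : Submodule F V) j = ⊥ := by
    induction j with
    | zero => rfl
    | succ j ih => rw [SS, ih]; simp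
  rw [this]; simp [h]

theorem main_count [Fintype F] (T : V →ₗ[F] V) (hT : IsNilpotent T) (l : V) (hl : l ≠ 0)
    (hk : LinearMap.ker T = Submodule.span F {l}) (N : ℕ) (m : ℕ) :
    ∀ μ : ℕ → ℕ, (∀ i, μ (i+1) ≤ μ i) → (∀ i, N ≤ i → μ i = 0) →
      ∑ i ∈ Finset.range N, μ i = m → m ≤ finrank F V →
      (∀ j, (1 - ((Fintype.card F : ℚ)⁻¹)^(μ 0)) * tau T l μ j
        = ff (Fintype.card F) N μ * (1 - ((Fintype.card F : ℚ)⁻¹)^(μ j))) ∧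
      (Nat.card {W : Submodule F V // Pr T μ W} : ℚ) = ff (Fintype.card F) N μ := by
  set q := Fintype.card F with hq
  have hq1 : 1 < q := Fintype.one_lt_card
  have hq0 : 0 < q := by omega
  have hqq : (1:ℚ) < q := by exact_mod_cast hq1
  induction m with
  | zero =>
    intro μ hμ hN hs _
    have hz : ∀ i, μ i = 0 := by
      intro i
      by_cases hi : N ≤ i
      · exact hN i hi
      · exact Finset.sum_eq_zero_iff.1 hs i (by simpa using hi)
    refine ⟨fun j => by simp [hz], ?_⟩
    rw [card_Pr_zero T μ hz]
    simp [ff, hz, GG_zero_right]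
  | succ m ih =>
    intro μ hμ hN hs hm
    have hanti : Antitone μ := antitone_nat_of_succ_le hμ
    have h0 : 0 < μ 0 := by
      rcases Nat.eq_zero_or_pos (μ 0) with h | h
      · have : ∑ i ∈ Finset.range N, μ i = 0 :=
          Finset.sum_eq_zero fun i _ => by have := hanti (Nat.zero_le i); omega
        omega
      · exact h
    -- the inductive hypothesis for the smaller partition
    have ih' : ∀ j b, μ j = b + 1 → μ (j+1) ≤ b →
        (∀ i, (1 - ((q : ℚ)⁻¹)^(Function.update μ j b 0)) * tau T l (Function.update μ j b) i
        = ff q N (Function.update μ j b) * (1 - ((q : ℚ)⁻¹)^(Function.update μ j b i))) ∧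
      (Nat.card {W : Submodule F V // Pr T (Function.update μ j b) W} : ℚ)
        = ff q N (Function.update μ j b) := by
      intro j b hb hb'
      have hjN : j < N := by
        by_contra h
        have := hN j (by omega)
        omega
      refine ih _ ?_ ?_ ?_ (by omega)
      · intro i
        have := hμ i
        rw [Function.update_apply, Function.update_apply]
        split_ifs with h1 h2 h2
        · omega
        · subst h1; omega
        · subst h2; omega
        · exact this
      · intro i hi
        rw [Function.update_of_ne (by omega)]; exact hN i hi
      · have := sum_update' μ j b hb N
        rw [if_pos hjN] at this
        omega
    have step : ∀ j, (1 - ((q : ℚ)⁻¹)^(μ 0)) * ((tau T l μ j : ℚ) - tau T l μ (j+1)) =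
        ff q N μ * (((q : ℚ)⁻¹)^(μ (j+1)) - ((q : ℚ)⁻¹)^(μ j)) := by
      intro j
      by_cases hj : μ j = μ (j+1)
      · rw [tau_eq_of_eq T l hl hk μ j hj, hj]; simp
      · obtain ⟨b, hb⟩ : ∃ b, μ j = b + 1 := ⟨μ j - 1, by have := hμ j; omega⟩
        have hb' : μ (j+1) ≤ b := by have := hμ j; omega
        have hjN : j < N := by
          by_contra h
          have := hN j (by omega)
          omega
        obtain ⟨i1, i2⟩ := ih' j b hb hb'
        rcases j with _ | k
        · rw [ff_zero q hq0 N hjN μ b hb, ← i2,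
            tau_rec_zero T hT l hl hk μ N hN (by omega) b hb]
          push_cast
          ring
        · rw [ff_succ q hq0 N k hjN μ b hb]
          have r := tau_rec_succ T hT l hl hk μ N hN (by omega) k b hb
          rw [← hq] at r
          have r' : (tau T l μ (k+1) : ℚ) + (q:ℚ) ^ b * tau T l (Function.update μ (k+1) b) (k+1) =
            tau T l μ (k+2) + (q:ℚ) ^ (μ k) * tau T l (Function.update μ (k+1) b) k := by
            exact_mod_cast r
          have j1 := i1 k
          have j2 := i1 (k+1)
          rw [Function.update_of_ne (by omega), Function.update_of_ne (by omega)] at j1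
          rw [Function.update_of_ne (by omega), Function.update_self] at j2
          have p : ∀ a : ℕ, (q:ℚ)^a * ((q:ℚ)⁻¹)^a = 1 := by
            intro a
            rw [← mul_pow, mul_inv_cancel₀ (by positivity), one_pow]
          change _ * ((tau T l μ (k+1) : ℚ) - tau T l μ (k+2)) = _
          linear_combination (1 - ((q : ℚ)⁻¹)^(μ 0)) * r' + (q:ℚ)^(μ k) * j1 - (q:ℚ)^b * j2
            - ff q N (Function.update μ (k+1) b) * (p (μ k) - p b)
    have all : ∀ j, (1 - ((q : ℚ)⁻¹)^(μ 0)) * tau T l μ j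
        = ff q N μ * (1 - ((q : ℚ)⁻¹)^(μ j)) := by
      have base : ∀ j, N ≤ j → (1 - ((q : ℚ)⁻¹)^(μ 0)) * tau T l μ j
        = ff q N μ * (1 - ((q : ℚ)⁻¹)^(μ j)) := by
        intro j hj
        rw [tau_vanish T hT l hk μ h0 j (hN j hj), hN j hj]; simp
      have down : ∀ d j, N ≤ j + d → (1 - ((q : ℚ)⁻¹)^(μ 0)) * tau T l μ j
        = ff q N μ * (1 - ((q : ℚ)⁻¹)^(μ j)) := by
        intro d
        induction d with
        | zero => intro j hj; exact base j hj
        | succ d ihd =>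
          intro j hj
          have a := ihd (j+1) (by omega)
          have b := step j
          linear_combination a + b
      intro j
      exact down N j (by omega)
    refine ⟨all, ?_⟩
    have a := all 0
    rw [tau_zero T l hl μ, mul_comm] at a
    refine mul_right_cancel₀ ?_ a
    have : ((q : ℚ)⁻¹)^(μ 0) < 1 := pow_lt_one₀ (by positivity) (inv_lt_one_of_one_lt₀ hqq) (by omega)
    linarith

end count
/-- If `Δ` is regular nilpotent (nilpotent with one-dimensional kernel),
then `σ(μ,Δ) = ∏_{i≥2} q^{μ_i²} [μ_{i-1} choose μ_i]_q`. -/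
theorem statement7 (q : ℕ) (hq : IsPrimePow q) (n : ℕ) (hn : 0 < n)
    (F : Type) [Field F] [Fintype F] (hF : Fintype.card F = q)
    (Δ : Matrix (Fin n) (Fin n) F)
    (hnilp : IsNilpotent Δ) (hker : Module.finrank F (LinearMap.ker Δ.mulVecLin) = 1)
    (μ : ℕ →₀ ℕ) (hμ : IsPtn μ) (hsize : ptnSize μ ≤ n) :
    (sigmaProf μ Δ : ℤ) =
      ∏ᶠ i : ℕ, (q : ℤ) ^ ((μ (i + 1)) ^ 2) * (qbp (μ i) (μ (i + 1))).eval (q : ℤ) := by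
  subst hF
  have hnil : IsNilpotent Δ.mulVecLin := by
    have := hnilp.map (Matrix.toLinAlgEquiv' (R := F) (n := Fin n))
    exact this
  obtain ⟨l, hl, hspan⟩ : ∃ l : Fin n → F, l ≠ 0 ∧
      LinearMap.ker Δ.mulVecLin = Submodule.span F {l} := by
    obtain ⟨v, hv, h⟩ := finrank_eq_one_iff'.1 hker
    refine ⟨v, fun h0 => hv (Subtype.ext h0), le_antisymm (fun x hx => ?_) ?_⟩
    · obtain ⟨c, hc⟩ := h ⟨x, hx⟩
      exact Submodule.mem_span_singleton.2 ⟨c, congrArg Subtype.val hc⟩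
    · rw [Submodule.span_singleton_le_iff_mem]; exact v.2
  obtain ⟨N, hN⟩ : ∃ N, ∀ i, N ≤ i → μ i = 0 := by
    refine ⟨μ.support.sup id + 1, fun i hi => ?_⟩
    by_contra h
    have := Finset.le_sup (f := id) (Finsupp.mem_support_iff.2 h)
    simp only [id] at this
    omega
  have hsupp : μ.support ⊆ Finset.range N := by
    intro i hi
    rw [Finset.mem_range]
    by_contra h
    exact (Finsupp.mem_support_iff.1 hi) (hN i (by omega))
  have hsum : ptnSize μ = ∑ i ∈ Finset.range N, μ i :=
    Finsupp.sum_of_support_subset μ hsupp _ (fun _ _ => rfl)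
  have hmain := (main_count Δ.mulVecLin hnil l hl hspan N _ μ hμ hN rfl
    (by rw [← hsum]; simpa using hsize)).2
  have hcard : sigmaProf μ Δ = Nat.card {W : Submodule F (Fin n → F) // Pr Δ.mulVecLin μ W} := by
    refine Nat.card_congr (Equiv.subtypeEquivRight fun W => ?_)
    constructor
    · intro h j
      rcases j with _ | j
      · exact finrank_bot F _
      · rw [← iterSpan_eq_SS]; exact h j
    · intro h j
      rw [iterSpan_eq_SS]; exact h (j+1)
  rw [finprod_eq_prod_of_mulSupport_subset (s := Finset.range N)]
  · have : ((sigmaProf μ Δ : ℤ) : ℚ) = ((∏ i ∈ Finset.range N,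
      ((Fintype.card F : ℕ) : ℤ) ^ ((μ (i + 1)) ^ 2) *
        (qbp (μ i) (μ (i + 1))).eval ((Fintype.card F : ℕ) : ℤ) : ℤ) : ℚ) := by
      rw [hcard, Int.cast_natCast, hmain, ff]
      push_cast
      rfl
    exact_mod_cast this
  · intro i hi
    rw [Finset.mem_coe, Finset.mem_range]
    by_contra h
    apply hi
    simp only
    rw [hN i (by omega), hN (i+1) (by omega)]
    simp [qbp]
end
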